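/- (Equilateral triangle, moderate length) Let D₁ = (−√3/3, 0), D₂ = (√3/6, −1/2), D₃ = (√3/6, 1/2) be the vertices of an equilateral triangle of side 1 in ℝ², and let √3 ≤ l ≤ 1 + √3/2. Then every solution of problem (enim) with D = {D₁,D₂,D₃} and total length l is, up to a rotation by 2π/3, the metric tree Γ₁ with vertices {V₁,V₂,V₃,V₄}, Dirichlet set {V₁,V₂,V₃}, and edges e₁₄, e₂₄, e₃₄ of lengths l₂₄ = l₃₄ = x and l₁₄ = √3/2 − √(x² − 1/4), where x ∈ [1/2, 1/√3] is uniquely determined by the total length constraint 2x + √3/2 − √(x² − 1/4) = l; moreover this Γ₁ admits an embedding γ with γ(V_i) = D_i (i = 1,2,3), so it also solves the embedded problem (enem). -/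

import Mathlib

open MeasureTheory Set Filter
open scoped ENNReal



/-- A metric graph: a finite combinatorial graph on `N` vertices (an irreflexive symmetric
edge relation) together with a positive length assigned to each edge. -/
structure MetricGraph where
  N : ℕ
  edge : Fin N → Fin N → Prop
  edge_symm : ∀ i j, edge i j → edge j i
  edge_irrefl : ∀ i, ¬ edge i i
  len : Fin N → Fin N → ℝ
  len_symm : ∀ i j, len i j = len j i
  len_pos : ∀ i j, edge i j → 0 < len i j

namespace MetricGraph

open scoped Classical in
/-- Total length of a metric graph: the sum of the lengths of its edges. -/
noncomputable def totalLength (G : MetricGraph) : ℝ :=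
  ∑ i : Fin G.N, ∑ j : Fin G.N, if i < j ∧ G.edge i j then G.len i j else 0

open scoped Classical in
/-- The number of (undirected) edges. -/
noncomputable def edgeCount (G : MetricGraph) : ℕ :=
  ∑ i : Fin G.N, ∑ j : Fin G.N, if i < j ∧ G.edge i j then 1 else 0

open scoped Classical in
/-- The degree of a vertex: the number of edges incident to it. -/
noncomputable def degree (G : MetricGraph) (i : Fin G.N) : ℕ :=
  ∑ j : Fin G.N, if G.edge i j then 1 else 0

/-- A metric graph is connected if it is nonempty and any two vertices are joined by a path. -/
def Connected (G : MetricGraph) : Prop :=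
  0 < G.N ∧ ∀ i j : Fin G.N, Relation.ReflTransGen G.edge i j

/-- The graph obtained by removing the (undirected) edge `{a, b}`. -/
def removeEdge (G : MetricGraph) (a b : Fin G.N) : MetricGraph where
  N := G.N
  edge i j := G.edge i j ∧ ¬((i = a ∧ j = b) ∨ (i = b ∧ j = a))
  edge_symm := fun i j h => ⟨G.edge_symm i j h.1, by tauto⟩
  edge_irrefl := fun i h => G.edge_irrefl i h.1
  len := G.len
  len_symm := G.len_symm
  len_pos := fun i j h => G.len_pos i j h.1

/-- A tree is a connected graph which becomes disconnected after the removal of any edge. -/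
def IsTree (G : MetricGraph) : Prop :=
  G.Connected ∧ ∀ a b, G.edge a b → ¬ (G.removeEdge a b).Connected

end MetricGraph

/-- A function in `H¹(Γ)` on a metric graph `Γ`: a family of `H¹` functions on the edges
(recorded together with their derivatives, via the fundamental theorem of calculus),
compatible with the orientation reversal `u ji x = u ij (l ij - x)` and continuous at
the vertices. -/
structure H1Fun (G : MetricGraph) where
  toFun : Fin G.N → Fin G.N → ℝ → ℝ
  deriv : Fin G.N → Fin G.N → ℝ → ℝ
  symm : ∀ i j, G.edge i j → ∀ x, toFun j i x = toFun i j (G.len i j - x)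
  vertexCont : ∀ i j k, G.edge i j → G.edge i k → toFun i j 0 = toFun i k 0
  deriv_integrable : ∀ i j, G.edge i j →
    MeasureTheory.IntegrableOn (deriv i j) (Set.Icc 0 (G.len i j))
  deriv_sq_integrable : ∀ i j, G.edge i j →
    MeasureTheory.IntegrableOn (fun t => (deriv i j t) ^ 2) (Set.Icc 0 (G.len i j))
  ftc : ∀ i j, G.edge i j → ∀ x ∈ Set.Icc (0 : ℝ) (G.len i j),
    toFun i j x = toFun i j 0 + ∫ t in (0 : ℝ)..x, deriv i j t

/-- `u` vanishes at every vertex of `W` (Dirichlet condition). -/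
def H1Fun.ZeroOn {G : MetricGraph} (u : H1Fun G) (W : Set (Fin G.N)) : Prop :=
  ∀ i ∈ W, ∀ j, G.edge i j → u.toFun i j 0 = 0

open scoped Classical in
/-- The functional `J(u) = ½∫_Γ |u'|² dx - ∫_Γ u dx`. -/
noncomputable def energyJ (G : MetricGraph) (u : H1Fun G) : ℝ :=
  ∑ i : Fin G.N, ∑ j : Fin G.N,
    if i < j ∧ G.edge i j then
      (1 / 2) * (∫ x in (0 : ℝ)..(G.len i j), (u.deriv i j x) ^ 2)
        - ∫ x in (0 : ℝ)..(G.len i j), u.toFun i j x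
    else 0

/-- The Dirichlet energy `E(Γ; W)`. -/
noncomputable def dirEnergy (G : MetricGraph) (W : Set (Fin G.N)) : ℝ :=
  sInf {e : ℝ | ∃ u : H1Fun G, u.ZeroOn W ∧ energyJ G u = e}

/-- An immersion of a metric graph into `ℝ^d`: a continuous map whose restriction to every
edge is an injective arc-length parametrized curve. -/
structure Immersion (G : MetricGraph) (d : ℕ) where
  toFun : Fin G.N → Fin G.N → ℝ → EuclideanSpace ℝ (Fin d)
  vpos : Fin G.N → EuclideanSpace ℝ (Fin d)
  start : ∀ i j, G.edge i j → toFun i j 0 = vpos i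
  symm : ∀ i j, G.edge i j → ∀ x, toFun j i x = toFun i j (G.len i j - x)
  arclen : ∀ i j, G.edge i j → ∀ s t : ℝ, 0 ≤ s → s ≤ t → t ≤ G.len i j →
    eVariationOn (toFun i j) (Set.Icc s t) = ENNReal.ofReal (t - s)
  inj : ∀ i j, G.edge i j → Set.InjOn (toFun i j) (Set.Icc 0 (G.len i j))

/-- An embedding is an injective immersion: the interiors of distinct edges are pairwise
disjoint and disjoint from all edges, and distinct vertices have distinct images. -/
def Immersion.IsEmbedding {G : MetricGraph} {d : ℕ} (γ : Immersion G d) : Prop :=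
  (∀ i j i' j', G.edge i j → G.edge i' j' → ¬((i = i' ∧ j = j') ∨ (i = j' ∧ j = i')) →
    ∀ x ∈ Set.Ioo (0 : ℝ) (G.len i j), ∀ y ∈ Set.Icc (0 : ℝ) (G.len i' j'),
      γ.toFun i j x ≠ γ.toFun i' j' y) ∧
  Function.Injective γ.vpos

/-- The Steiner length of a set `D ⊆ ℝ^d`: the infimum of the `H¹` lengths of the closed
connected sets containing `D`. -/
noncomputable def SteinerLen {d : ℕ} (D : Set (EuclideanSpace ℝ (Fin d))) : ℝ :=
  sInf {l : ℝ | 0 ≤ l ∧ ∃ C : Set (EuclideanSpace ℝ (Fin d)),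
    IsClosed C ∧ IsConnected C ∧ D ⊆ C ∧ μH[1] C = ENNReal.ofReal l}

/-- The point `(a, b)` of the Euclidean plane. -/
noncomputable def pt (a b : ℝ) : EuclideanSpace ℝ (Fin 2) :=
  (WithLp.equiv 2 (Fin 2 → ℝ)).symm ![a, b]

/-- `Γ` has the shape of the metric tree `Γ₁` of parameter `x`: four vertices, the three
Dirichlet vertices `v₁, v₂, v₃` joined to the center `v₄` by edges of lengths
`√3/2 - √(x² - 1/4)`, `x`, `x` respectively. -/
def Gamma1Shape (x : ℝ) (G : MetricGraph) (V : Set (Fin G.N)) : Prop :=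
  ∃ v₁ v₂ v₃ v₄ : Fin G.N,
    v₁ ≠ v₂ ∧ v₁ ≠ v₃ ∧ v₁ ≠ v₄ ∧ v₂ ≠ v₃ ∧ v₂ ≠ v₄ ∧ v₃ ≠ v₄ ∧
    G.N = 4 ∧ V = {v₁, v₂, v₃} ∧
    (∀ i j, G.edge i j ↔ (({i, j} : Set (Fin G.N)) = {v₁, v₄} ∨
      ({i, j} : Set (Fin G.N)) = {v₂, v₄} ∨ ({i, j} : Set (Fin G.N)) = {v₃, v₄})) ∧
    G.len v₁ v₄ = Real.sqrt 3 / 2 - Real.sqrt (x ^ 2 - 1 / 4) ∧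
    G.len v₂ v₄ = x ∧ G.len v₃ v₄ = x


/-- The energy of a star with three Dirichlet leaves and arms `a`, `b`, `c`, up to sign. -/
noncomputable def starF (a b c : ℝ) : ℝ :=
  (a ^ 3 + b ^ 3 + c ^ 3) / 24 + (a + b + c) ^ 2 / (8 * (1 / a + 1 / b + 1 / c))

theorem starF_rotate (a b c : ℝ) : starF a b c = starF b c a := by
  unfold starF; ring_nf

/-- The star energy in terms of the mean arm length and the deviations from it. -/
theorem starF_eq {a b c m S π : ℝ} (ha : 0 < a) (hb : 0 < b) (hc : 0 < c)
    (hm : 3 * m = a + b + c)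
    (hS : 6 * S = (a - m) ^ 2 + (b - m) ^ 2 + (c - m) ^ 2)
    (hπ : π = (a - m) * (b - m) * (c - m)) :
    0 < m ^ 2 - S ∧
    8 * starF a b c = 4 * m ^ 3 + 4 * π - 3 * S * (2 * m * S - π) / (m ^ 2 - S) := by
  have e2 : m ^ 2 - S = (a * b + b * c + c * a) / 3 := by
    have : m = (a + b + c) / 3 := by linarith
    subst this; nlinarith
  have e2pos : 0 < a * b + b * c + c * a := by positivity
  refine ⟨by rw [e2]; positivity, ?_⟩
  rw [e2]
  have hSv : S = ((a - m) ^ 2 + (b - m) ^ 2 + (c - m) ^ 2) / 6 := by linarith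
  have hmv : m = (a + b + c) / 3 := by linarith
  have h1 : 1 / a + 1 / b + 1 / c = (a * b + b * c + c * a) / (a * b * c) := by
    field_simp; ring
  unfold starF
  rw [h1, hπ, hSv, hmv]
  field_simp
  ring

set_option maxHeartbeats 1000000 in
theorem core_compare {m S π z δ drop : ℝ} (hm0 : 0.577 ≤ m) (hm1 : m ≤ 0.6221)
    (hz0 : 0 ≤ z) (hz1 : z ≤ 0.1221) (hδ0 : 0 ≤ δ) (hδ1 : δ ≤ 0.134) (hδz : δ ≤ 9.4 * z ^ 2)
    (hS0 : 0 ≤ S) (hSm : 0 < m ^ 2 - S) (hπ : π ^ 2 ≤ 4 * S ^ 3)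
    (hz : 3 * m ^ 2 - 1 = (36 * m ^ 2 - 6) * z ^ 2 + 9 * z ^ 4 + 36 * m * z ^ 3)
    (hK : (36 * m ^ 2 - 6) * S + 9 * S ^ 2 + 18 * m * π + drop ≤ 3 * m ^ 2 - 1)
    (hdrop : 1.9 * δ ^ 2 ≤ drop) :
    4 * m ^ 3 + 4 * π - 3 * S * (2 * m * S - π) / (m ^ 2 - S) + δ ^ 3 ≤
      4 * m ^ 3 + 8 * z ^ 3 - 6 * z ^ 4 / (m + z) ∧
    (4 * m ^ 3 + 4 * π - 3 * S * (2 * m * S - π) / (m ^ 2 - S) + δ ^ 3 =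
      4 * m ^ 3 + 8 * z ^ 3 - 6 * z ^ 4 / (m + z) → δ = 0 ∧ S = z ^ 2 ∧ π = 2 * z ^ 3) := by
  obtain ⟨ζ, hζ0, rfl⟩ : ∃ ζ : ℝ, 0 ≤ ζ ∧ S = ζ ^ 2 :=
    ⟨Real.sqrt S, Real.sqrt_nonneg _, (Real.sq_sqrt hS0).symm⟩
  have hπ' : π ≤ 2 * ζ ^ 3 := by
    apply le_of_sq_le_sq _ (by positivity)
    linarith
  have hm : 0 < m := by linarith
  have hζm : ζ < m := by
    by_contra! h
    nlinarith only [h, hSm, hm]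
  have key : 6 * ζ ^ 4 / (m + ζ) ≤ 3 * ζ ^ 2 * (2 * m * ζ ^ 2 - π) / (m ^ 2 - ζ ^ 2) := by
    rw [div_le_div_iff₀ (by positivity) hSm]
    have : 6 * ζ ^ 4 * (m ^ 2 - ζ ^ 2) = 3 * ζ ^ 2 * (2 * m * ζ ^ 2 - 2 * ζ ^ 3) * (m + ζ) := by
      ring
    rw [this]
    gcongr
  have hm2 : 0.332 ≤ m ^ 2 := by nlinarith only [hm0]
  have hm3 : m ^ 2 ≤ 0.3871 := by nlinarith only [hm0, hm1]
  by_cases hcase : z ≤ ζ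
  · have mono : 6 * z ^ 4 / (m + z) ≤ 6 * ζ ^ 4 / (m + ζ) := by
      rw [div_le_div_iff₀ (by positivity) (by positivity)]
      have h3 : z ^ 3 ≤ ζ ^ 3 := by gcongr
      have h4 : z ^ 4 ≤ ζ ^ 4 := by gcongr
      have : z ^ 4 * ζ ≤ ζ ^ 4 * z := by
        have := mul_le_mul_of_nonneg_left h3 (mul_nonneg hz0 hζ0)
        linear_combination this
      have h5 := mul_le_mul_of_nonneg_left h4 hm.le
      linear_combination 6 * this + 6 * h5
    have hT : 0 ≤ ζ ^ 2 - z ^ 2 := by nlinarith only [hz0, hcase]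
    have hT4 : 0 ≤ ζ ^ 4 - z ^ 4 := by
      have : z ^ 4 ≤ ζ ^ 4 := by gcongr
      linarith
    have hD : (36 * m ^ 2 - 6) * (ζ ^ 2 - z ^ 2) + 1.9 * δ ^ 2 ≤ 18 * m * (2 * z ^ 3 - π) := by
      linarith
    have hD1 : 5 * (ζ ^ 2 - z ^ 2) + 1.9 * δ ^ 2 ≤ 18 * m * (2 * z ^ 3 - π) := by
      nlinarith only [hD, hT, hm2]
    have hDn : 0 ≤ 2 * z ^ 3 - π := by
      by_contra! h
      nlinarith only [sq_nonneg δ, hm, h, hD1, hT]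
    have hD2 : 5 * (ζ ^ 2 - z ^ 2) + 1.9 * δ ^ 2 ≤ 11.2 * (2 * z ^ 3 - π) := by
      nlinarith only [hD1, hDn, hm1]
    have hδ3 : δ ^ 3 ≤ 0.134 * δ ^ 2 := by nlinarith only [hδ1, sq_nonneg δ]
    constructor
    · linarith [sq_nonneg δ]
    · intro heq
      have h0 : 4 * (2 * z ^ 3 - π) ≤ δ ^ 3 := by linarith
      have hδ : δ ^ 2 ≤ 0 := by linarith [sq_nonneg δ]
      have hδ' : δ = 0 := by simpa using le_antisymm hδ (sq_nonneg δ)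
      subst hδ'
      refine ⟨rfl, ?_, ?_⟩ <;> linarith
  · push Not at hcase
    have hzpos : 0 < z := lt_of_le_of_lt hζ0 hcase
    set Q := z ^ 3 - ζ ^ 3 with hQ
    have hQD : 2 * Q ≤ 2 * z ^ 3 - π := by rw [hQ]; linarith
    have hQpos : 0 < Q := by
      have : ζ ^ 3 < z ^ 3 := by gcongr
      rw [hQ]; linarith
    have h4 : z ^ 4 - ζ ^ 4 ≤ 4 / 3 * z * Q := by
      have : 4 / 3 * z * Q - (z ^ 4 - ζ ^ 4) =
          (z - ζ) ^ 2 * (z ^ 2 + 2 * z * ζ + 3 * ζ ^ 2) / 3 := by rw [hQ]; ring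
      have : 0 ≤ (z - ζ) ^ 2 * (z ^ 2 + 2 * z * ζ + 3 * ζ ^ 2) / 3 := by positivity
      linarith
    have mono : 6 * ζ ^ 4 / (m + z) ≤ 6 * ζ ^ 4 / (m + ζ) := by gcongr
    have hfrac : 6 * z ^ 4 / (m + z) - 6 * ζ ^ 4 / (m + z) ≤ 8 * Q * 0.175 := by
      rw [← sub_div, div_le_iff₀ (by positivity)]
      have h5 : z ≤ 0.175 * (m + z) := by linarith
      nlinarith only [h5, h4, hQpos]
    have hD : 3.3 * (2 * z ^ 3 - π) ≤ 4 * (2 * z ^ 3 - π) - 6 * z ^ 4 / (m + z) +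
        6 * ζ ^ 4 / (m + ζ) := by linarith
    have hlt : δ ^ 3 < 3.3 * (2 * z ^ 3 - π) := by
      by_contra! hcon
      have hδpos : 0 < δ := by
        by_contra! h
        have : δ = 0 := le_antisymm h hδ0
        subst this
        norm_num at hcon
        linarith
      have hTz : (z ^ 2 - ζ ^ 2) * z ≤ Q := by
        have : Q - (z ^ 2 - ζ ^ 2) * z = ζ ^ 2 * (z - ζ) := by rw [hQ]; ring
        have : 0 ≤ ζ ^ 2 * (z - ζ) := by
          have : 0 ≤ z - ζ := by linarith
          positivity
        linarith
      have hT1 : 6.6 * ((z ^ 2 - ζ ^ 2) * z) ≤ δ ^ 3 := by linarith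
      have hT2 : δ ^ 3 ≤ (δ ^ 2 * (9.4 * 0.1221)) * z := by
        have : δ ≤ 9.4 * 0.1221 * z := by nlinarith only [hδz, hz1, hzpos]
        nlinarith only [this, sq_nonneg δ]
      have hT3 : z ^ 2 - ζ ^ 2 ≤ 0.1740 * δ ^ 2 := by
        by_contra! h
        have := mul_lt_mul_of_pos_right h hzpos
        nlinarith only [this, hT1, hT2, mul_nonneg (sq_nonneg δ) hz0]
      have hT0 : 0 ≤ z ^ 2 - ζ ^ 2 := by nlinarith only [hζ0, hcase]
      have hDle : 2 * z ^ 3 - π ≤ 0.0407 * δ ^ 2 := by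
        have : δ ^ 3 ≤ 0.134 * δ ^ 2 := by nlinarith only [hδ1, sq_nonneg δ]
        linarith
      have hz2 : z ^ 2 ≤ 0.0150 := by nlinarith only [hz0, hz1]
      have hmain : 1.9 * δ ^ 2 ≤ (36 * m ^ 2 - 6 + 9 * (z ^ 2 + ζ ^ 2)) * (z ^ 2 - ζ ^ 2) +
          18 * m * (2 * z ^ 3 - π) := by linarith
      have hc1 : (36 * m ^ 2 - 6 + 9 * (z ^ 2 + ζ ^ 2)) * (z ^ 2 - ζ ^ 2) ≤
          8.21 * (z ^ 2 - ζ ^ 2) := by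
        apply mul_le_mul_of_nonneg_right _ hT0
        linarith
      have hc2 : 18 * m * (2 * z ^ 3 - π) ≤ 11.2 * (2 * z ^ 3 - π) := by
        apply mul_le_mul_of_nonneg_right _ (by linarith)
        linarith
      have : 0 < δ ^ 2 := by positivity
      linarith
    constructor
    · linarith
    · intro heq; linarith

/-- The Cayley-type form vanishing at the squared distances from a point of the plane to the
vertices of an equilateral triangle of side one. -/
def triangleForm (A B C : ℝ) : ℝ :=
  A ^ 2 + B ^ 2 + C ^ 2 - A * B - B * C - C * A - A - B - C + 1

theorem triangleForm_eq {a b c m S π : ℝ} (hm : 3 * m = a + b + c)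
    (hS : 6 * S = (a - m) ^ 2 + (b - m) ^ 2 + (c - m) ^ 2)
    (hπ : π = (a - m) * (b - m) * (c - m)) :
    triangleForm (a ^ 2) (b ^ 2) (c ^ 2) =
      1 - 3 * m ^ 2 + (36 * m ^ 2 - 6) * S + 9 * S ^ 2 + 18 * m * π := by
  have hSv : S = ((a - m) ^ 2 + (b - m) ^ 2 + (c - m) ^ 2) / 6 := by linarith
  have hmv : m = (a + b + c) / 3 := by linarith
  rw [hπ, hSv, hmv, triangleForm]
  ring

theorem drop_bound {a a₁ δ E s : ℝ} (hδ : δ = a - a₁) (hδ0 : 0 ≤ δ) (hδ1 : δ ≤ 0.134)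
    (ha : a ^ 2 ≤ 3 / 4) (ha1 : 0.133 ≤ a₁) (hs1 : 1 ≤ s) (hs : 1.732 - a ≤ s)
    (hE : s ^ 2 ≤ 2 * E) :
    1.9 * δ ≤ (a + a₁) * (E + 1 - a ^ 2 - a₁ ^ 2) := by
  obtain rfl : a₁ = a - δ := by linarith
  have hE1 : 0.5 ≤ E := by nlinarith only [hs1, hE]
  rcases le_total a 0.45 with h1 | h1
  · have h2 : 0.82 ≤ E := by nlinarith only [hE, hs, h1]
    have h3 : 1.415 ≤ E + 1 - a ^ 2 - (a - δ) ^ 2 := by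
      nlinarith only [h2, h1, ha1, hδ0]
    nlinarith only [h3, ha1, hδ0, hδ1]
  rcases le_total a 0.65 with h2 | h2
  · have h3 : 0.58 ≤ E := by nlinarith only [hE, hs, h2]
    have h4 : 0.73 ≤ E + 1 - a ^ 2 - (a - δ) ^ 2 := by
      nlinarith only [h3, h2, ha1, hδ0]
    nlinarith only [h4, h1, hδ0, hδ1]
  rcases le_total a 0.78 with h3 | h3
  · have h4 : 0.283 ≤ E + 1 - a ^ 2 - (a - δ) ^ 2 := by
      nlinarith only [hE1, h3, ha1, hδ0]
    nlinarith only [h4, h2, hδ0, hδ1]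
  · have hr : 1.426 ≤ a + (a - δ) := by linarith
    have h4 : (a + (a - δ)) * δ ≤ E + 1 - a ^ 2 - (a - δ) ^ 2 := by
      nlinarith only [hE1, ha]
    have h5 : 1.9 ≤ (a + (a - δ)) ^ 2 := by nlinarith only [hr]
    calc 1.9 * δ ≤ (a + (a - δ)) ^ 2 * δ := by gcongr
      _ = (a + (a - δ)) * ((a + (a - δ)) * δ) := by ring
      _ ≤ _ := by gcongr

theorem eq_of_elementary {z α β γ : ℝ} (h0 : α + β + γ = 0)
    (hS : 6 * z ^ 2 = α ^ 2 + β ^ 2 + γ ^ 2) (hπ : 2 * z ^ 3 = α * β * γ) :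
    (α = 2 * z ∧ β = -z ∧ γ = -z) ∨ (β = 2 * z ∧ γ = -z ∧ α = -z) ∨
      (γ = 2 * z ∧ α = -z ∧ β = -z) := by
  have e2 : α * β + β * γ + γ * α = -3 * z ^ 2 := by
    linear_combination (1 / 2) * (α + β + γ) * h0 + (1 / 2) * hS
  have root : ∀ t, (t - α) * (t - β) * (t - γ) = (t - 2 * z) * (t + z) ^ 2 := by
    intro t
    linear_combination -t ^ 2 * h0 + t * e2 + hπ
  have mem : ∀ t, (t - α) * (t - β) * (t - γ) = 0 → t = 2 * z ∨ t = -z := by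
    intro t ht
    rw [root t] at ht
    rcases mul_eq_zero.1 ht with h | h
    · left; linarith
    · right
      have := pow_eq_zero_iff (two_ne_zero) |>.1 h
      linarith
  have hα := mem α (by ring)
  have hβ := mem β (by ring)
  have hγ := mem γ (by ring)
  rcases hα with hα | hα
  · left
    rcases hβ with hβ | hβ <;> rcases hγ with hγ | hγ <;>
      exact ⟨hα, by linarith, by linarith⟩
  · right
    rcases hβ with hβ | hβ <;> rcases hγ with hγ | hγ
    · exact Or.inl ⟨hβ, by linarith, hα⟩
    · exact Or.inl ⟨hβ, hγ, hα⟩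
    · exact Or.inr ⟨hγ, hα, hβ⟩
    · exact Or.inr ⟨by linarith, hα, hβ⟩

set_option maxHeartbeats 1000000 in
/-- Among tripods of given total length spanning the three vertices, and even when an arm has
been enlarged by `δ`, the symmetric star is optimal. -/
theorem star_compare {x y a b c δ : ℝ} (hy : 0 ≤ y) (hxy : x ^ 2 = 1 / 4 + y ^ 2)
    (hx0 : 1 / 2 ≤ x) (hx1 : 3 * x ^ 2 ≤ 1)
    (hl : a + b + c = 2 * x + √3 / 2 - y) (hl2 : a + b + c ≤ 1 + √3 / 2)
    (hδ : 0 ≤ δ) (hab : 1 ≤ a - δ + b) (hac : 1 ≤ a - δ + c) (hbc : 1 ≤ b + c)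
    (hF : √3 ≤ a - δ + b + c) (hK : triangleForm ((a - δ) ^ 2) (b ^ 2) (c ^ 2) ≤ 0) :
    starF a b c + δ ^ 3 / 8 ≤ starF (√3 / 2 - y) x x ∧
    (starF a b c + δ ^ 3 / 8 = starF (√3 / 2 - y) x x → δ = 0 ∧
      ((a = √3 / 2 - y ∧ b = x ∧ c = x) ∨ (b = √3 / 2 - y ∧ c = x ∧ a = x) ∨
        (c = √3 / 2 - y ∧ a = x ∧ b = x))) := by
  have hr2 : √3 ^ 2 = 3 := Real.sq_sqrt (by norm_num)
  have hr0 : 0 < √3 := by positivity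
  generalize √3 = r at *
  have hr1 : 1.732 ≤ r := by nlinarith only [hr0, hr2]
  have hr3 : r ≤ 1.73206 := by nlinarith only [hr0, hr2]
  have hxr : x ≤ r / 3 := by nlinarith only [hr0, hr2, hx1]
  have hyr : y ≤ r / 6 := by nlinarith only [hr0, hr2, hx1, hxy]
  have hδ1 : δ ≤ 0.134 := by linarith
  have ha2 : a ≤ r / 2 := by linarith
  have ha1 : 0.133 ≤ a - δ := by linarith
  have hb : 0 < b := by linarith
  have hc : 0 < c := by linarith
  obtain ⟨m, hm⟩ : ∃ m, 3 * m = a + b + c := ⟨(a + b + c) / 3, by ring⟩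
  obtain ⟨z, hz⟩ : ∃ z, 3 * z = r / 2 - y - x := ⟨(r / 2 - y - x) / 3, by ring⟩
  obtain ⟨S, hS⟩ : ∃ S, 6 * S = (a - m) ^ 2 + (b - m) ^ 2 + (c - m) ^ 2 :=
    ⟨((a - m) ^ 2 + (b - m) ^ 2 + (c - m) ^ 2) / 6, by ring⟩
  have hm' : 3 * m = (r / 2 - y) + x + x := by linarith
  have hS' : 6 * z ^ 2 = (r / 2 - y - m) ^ 2 + (x - m) ^ 2 + (x - m) ^ 2 := by
    have e1 : r / 2 - y - m = 2 * z := by linarith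
    have e2 : x - m = -z := by linarith
    rw [e1, e2]; ring
  have hπ' : 2 * z ^ 3 = (r / 2 - y - m) * (x - m) * (x - m) := by
    have e1 : r / 2 - y - m = 2 * z := by linarith
    have e2 : x - m = -z := by linarith
    rw [e1, e2]; ring
  have hz0 : 0 ≤ z := by linarith
  have hz1 : z ≤ 0.1221 := by linarith
  have hm0 : 0.577 ≤ m := by linarith
  have hm1 : m ≤ 0.6221 := by linarith
  obtain ⟨hSm, hFa⟩ := starF_eq (by linarith) hb hc hm hS rfl
  obtain ⟨hzm, hFx⟩ := starF_eq (by linarith) (by linarith) (by linarith) hm' hS' hπ'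
  have hzeq : 3 * m ^ 2 - 1 = (36 * m ^ 2 - 6) * z ^ 2 + 9 * z ^ 4 + 36 * m * z ^ 3 := by
    have h1 := triangleForm_eq hm' hS' hπ'
    have h2 : triangleForm ((r / 2 - y) ^ 2) (x ^ 2) (x ^ 2) = 0 := by
      rw [hxy, triangleForm]
      linear_combination ((r ^ 2 + 3) / 16 - r * y / 2 + y ^ 2 - 3 / 8) * hr2
    linear_combination h1 - h2
  have hδz : δ ≤ 9.4 * z ^ 2 := by
    have h1 : δ * (2 * r) ≤ 9 * m ^ 2 - 3 := by
      have h3 : 0 ≤ 3 * m - r - δ := by linarith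
      nlinarith only [mul_nonneg h3 hr0.le, mul_nonneg h3 hδ, sq_nonneg δ, hr2, sq_nonneg (3 * m - r),
        mul_nonneg h3 h3]
    have h2 : 3 * m ^ 2 - 1 ≤ 10.85 * z ^ 2 := by
      rw [hzeq]
      nlinarith only [mul_nonneg (sq_nonneg z) (mul_nonneg hz0 (sub_nonneg.2 hm1)),
        mul_nonneg (sq_nonneg z) (sub_nonneg.2 hz1), sq_nonneg z,
        mul_nonneg (sq_nonneg z) (mul_nonneg hz0 (sub_nonneg.2 hz1)),
        mul_nonneg (sq_nonneg z) (show (0:ℝ) ≤ 0.3871 - m ^ 2 by nlinarith only [hm0, hm1])]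
    nlinarith only [h1, h2, hr1, hδ, sq_nonneg z]
  have hdrop : 1.9 * δ ^ 2 ≤
      δ * ((a + (a - δ)) * (b ^ 2 + c ^ 2 + 1 - a ^ 2 - (a - δ) ^ 2)) := by
    have := drop_bound (a := a) (a₁ := a - δ) (δ := δ) (E := b ^ 2 + c ^ 2) (s := b + c)
      (by ring) hδ hδ1 (by nlinarith only [ha2, hr2, ha1, hδ]) ha1 hbc (by linarith)
      (by nlinarith only [sq_nonneg (b - c)])
    calc 1.9 * δ ^ 2 = δ * (1.9 * δ) := by ring
      _ ≤ _ := by gcongr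
  have hKK := triangleForm_eq hm hS rfl
  have hS0 : 0 ≤ S := by
    have : 0 ≤ (a - m) ^ 2 + (b - m) ^ 2 + (c - m) ^ 2 := by positivity
    linarith
  have hdisc : ((a - m) * (b - m) * (c - m)) ^ 2 ≤ 4 * S ^ 3 := by
    have e1 : S = ((a - m) ^ 2 + (b - m) ^ 2 + (c - m) ^ 2) / 6 := by linarith
    have e2 : c - m = -(a - m) - (b - m) := by linarith
    rw [e1, e2]
    have : 0 ≤ ((a - m - (b - m)) * (2 * (a - m) + (b - m)) * ((a - m) + 2 * (b - m))) ^ 2 := by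
      positivity
    linear_combination this / 27
  obtain ⟨h1, h2⟩ := core_compare hm0 hm1 hz0 hz1 hδ hδ1 hδz hS0 hSm hdisc hzeq
    (drop := δ * ((a + (a - δ)) * (b ^ 2 + c ^ 2 + 1 - a ^ 2 - (a - δ) ^ 2)))
    (by unfold triangleForm at hK hKK; linear_combination hK - hKK) hdrop
  have hfrac : 3 * z ^ 2 * (2 * m * z ^ 2 - 2 * z ^ 3) / (m ^ 2 - z ^ 2) =
      6 * z ^ 4 / (m + z) := by
    have : 0 < m - z := by linarith
    have : 0 < m + z := by linarith
    have e : m ^ 2 - z ^ 2 = (m - z) * (m + z) := by ring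
    rw [e]
    field_simp
    ring
  rw [hfrac] at hFx
  constructor
  · linarith
  · intro heq
    obtain ⟨hδ0, hSz, hπz⟩ := h2 (by linarith)
    refine ⟨hδ0, ?_⟩
    rcases eq_of_elementary (by linarith) (by rw [← hSz]; exact hS) hπz.symm with h | h | h
    · exact Or.inl ⟨by linarith, by linarith, by linarith⟩
    · exact Or.inr (Or.inl ⟨by linarith, by linarith, by linarith⟩)
    · exact Or.inr (Or.inr ⟨by linarith, by linarith, by linarith⟩)

theorem triangleForm_nonpos {A B C A₀ B₀ C₀ : ℝ} (h0 : triangleForm A₀ B₀ C₀ = 0)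
    (hA : A₀ ≤ A) (hB : B₀ ≤ B) (hC : C₀ ≤ C) (hA' : A ≤ 3 / 4) (hB' : B ≤ 3 / 4)
    (hC' : C ≤ 3 / 4) (hAB : 1 / 2 ≤ A₀ + B₀) (hBC : 1 / 2 ≤ B₀ + C₀)
    (hCA : 1 / 2 ≤ C₀ + A₀) : triangleForm A B C ≤ 0 := by
  have h : triangleForm A B C - triangleForm A₀ B₀ C₀ =
      (A - A₀) * ((A + A₀) - (B + B₀) / 2 - (C + C₀) / 2 - 1) +
      (B - B₀) * ((B + B₀) - (A + A₀) / 2 - (C + C₀) / 2 - 1) +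
      (C - C₀) * ((C + C₀) - (A + A₀) / 2 - (B + B₀) / 2 - 1) := by
    unfold triangleForm; ring
  have h1 := mul_nonneg (sub_nonneg.2 hA)
    (show 0 ≤ -((A + A₀) - (B + B₀) / 2 - (C + C₀) / 2 - 1) by linarith)
  have h2 := mul_nonneg (sub_nonneg.2 hB)
    (show 0 ≤ -((B + B₀) - (A + A₀) / 2 - (C + C₀) / 2 - 1) by linarith)
  have h3 := mul_nonneg (sub_nonneg.2 hC)
    (show 0 ≤ -((C + C₀) - (A + A₀) / 2 - (B + B₀) / 2 - 1) by linarith)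
  linarith

/-- The constraints on the arms of a tripod spanning the vertices of the triangle. -/
structure TripodArms (a b c : ℝ) : Prop where
  ab : 1 ≤ a + b
  bc : 1 ≤ b + c
  ca : 1 ≤ c + a
  fermat : √3 ≤ a + b + c
  form : triangleForm (a ^ 2) (b ^ 2) (c ^ 2) ≤ 0

theorem TripodArms.rotate {a b c : ℝ} (h : TripodArms a b c) : TripodArms b c a :=
  ⟨h.bc, h.ca, h.ab, by linarith [h.fermat], by
    have := h.form
    unfold triangleForm at *
    linarith⟩

theorem dist_pt (P : EuclideanSpace ℝ (Fin 2)) (a b : ℝ) :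
    dist P (pt a b) = √((P 0 - a) ^ 2 + (P 1 - b) ^ 2) := by
  rw [EuclideanSpace.dist_eq, Fin.sum_univ_two]
  simp [pt, Real.dist_eq, sq_abs]

theorem dist_pt_pt (a b a' b' : ℝ) :
    dist (pt a b) (pt a' b') = √((a - a') ^ 2 + (b - b') ^ 2) := by
  rw [dist_pt]; simp [pt]

theorem tripodArms_of_dist {P : EuclideanSpace ℝ (Fin 2)} {a b c : ℝ}
    (ha : dist P (pt (-√3 / 3) 0) ≤ a) (hb : dist P (pt (√3 / 6) (-(1 / 2))) ≤ b)
    (hc : dist P (pt (√3 / 6) (1 / 2)) ≤ c) (hl : a + b + c ≤ 1 + √3 / 2) :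
    TripodArms a b c := by
  have h3 : √3 ^ 2 = 3 := Real.sq_sqrt (by norm_num)
  have h30 : 0 < √3 := by positivity
  have d12 : dist (pt (-√3 / 3) 0) (pt (√3 / 6) (-(1 / 2))) = 1 := by
    rw [dist_pt_pt, Real.sqrt_eq_one]; linear_combination h3 / 4
  have d13 : dist (pt (-√3 / 3) 0) (pt (√3 / 6) (1 / 2)) = 1 := by
    rw [dist_pt_pt, Real.sqrt_eq_one]; linear_combination h3 / 4
  have d23 : dist (pt (√3 / 6) (-(1 / 2))) (pt (√3 / 6) (1 / 2)) = 1 := by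
    rw [dist_pt_pt, Real.sqrt_eq_one]; norm_num
  have t12 := dist_triangle_left (pt (-√3 / 3) 0) (pt (√3 / 6) (-(1 / 2))) P
  have t13 := dist_triangle_left (pt (-√3 / 3) 0) (pt (√3 / 6) (1 / 2)) P
  have t23 := dist_triangle_left (pt (√3 / 6) (-(1 / 2))) (pt (√3 / 6) (1 / 2)) P
  rw [d12] at t12
  rw [d13] at t13
  rw [d23] at t23
  have f1 : P 0 + √3 / 3 ≤ dist P (pt (-√3 / 3) 0) := by
    rw [dist_pt]
    apply Real.le_sqrt_of_sq_le
    nlinarith [sq_nonneg (P 1)]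
  have f2 : (√3 / 6 - P 0) / 2 + √3 / 2 * (1 / 2 + P 1) ≤
      dist P (pt (√3 / 6) (-(1 / 2))) := by
    rw [dist_pt]
    apply Real.le_sqrt_of_sq_le
    have h := sq_nonneg (√3 / 2 * (√3 / 6 - P 0) - (1 / 2 + P 1) / 2)
    linear_combination h + h3 * ((√3 / 6 - P 0) ^ 2 + (1 / 2 + P 1) ^ 2) / 4
  have f3 : (√3 / 6 - P 0) / 2 + √3 / 2 * (1 / 2 - P 1) ≤
      dist P (pt (√3 / 6) (1 / 2)) := by
    rw [dist_pt]
    apply Real.le_sqrt_of_sq_le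
    have h := sq_nonneg (√3 / 2 * (√3 / 6 - P 0) - (1 / 2 - P 1) / 2)
    linear_combination h + h3 * ((√3 / 6 - P 0) ^ 2 + (1 / 2 - P 1) ^ 2) / 4
  have hform : triangleForm (dist P (pt (-√3 / 3) 0) ^ 2)
      (dist P (pt (√3 / 6) (-(1 / 2))) ^ 2) (dist P (pt (√3 / 6) (1 / 2)) ^ 2) = 0 := by
    rw [dist_pt, dist_pt, dist_pt, Real.sq_sqrt (by positivity), Real.sq_sqrt (by positivity),
      Real.sq_sqrt (by positivity), triangleForm]
    rw [show (P 0 - -√3 / 3) ^ 2 + (P 1 - 0) ^ 2 = P 0 ^ 2 + P 1 ^ 2 + 1 / 3 + 2 * (√3 * P 0 / 3) by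
        linear_combination h3 / 9,
      show (P 0 - √3 / 6) ^ 2 + (P 1 - -(1 / 2)) ^ 2 =
        P 0 ^ 2 + P 1 ^ 2 + 1 / 3 - √3 * P 0 / 3 + P 1 by linear_combination h3 / 36,
      show (P 0 - √3 / 6) ^ 2 + (P 1 - 1 / 2) ^ 2 =
        P 0 ^ 2 + P 1 ^ 2 + 1 / 3 - √3 * P 0 / 3 - P 1 by linear_combination h3 / 36]
    linear_combination h3 * P 0 ^ 2
  have key : ∀ {p q r A B C : ℝ}, 0 ≤ p → 0 ≤ q → p ≤ A → q ≤ B → 1 ≤ A + C → r ≤ C →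
      A + B + C ≤ 1 + √3 / 2 → 1 ≤ p + q → B ^ 2 ≤ 3 / 4 ∧ 1 / 2 ≤ p ^ 2 + q ^ 2 := by
    intro p q r A B C hp hq hA hB hAC hr h hpq
    constructor
    · nlinarith
    · nlinarith [sq_nonneg (p - q)]
  have p1 := dist_nonneg (x := P) (y := pt (-√3 / 3) 0)
  have p2 := dist_nonneg (x := P) (y := pt (√3 / 6) (-(1 / 2)))
  have p3 := dist_nonneg (x := P) (y := pt (√3 / 6) (1 / 2))
  obtain ⟨k1, l1⟩ := key p1 p2 ha hb (by linarith) hc hl t12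
  obtain ⟨k2, l2⟩ := key p2 p3 hb hc (by linarith) ha (by linarith) t23
  obtain ⟨k3, l3⟩ := key p3 p1 hc ha (by linarith) hb (by linarith) (by linarith)
  exact ⟨by linarith, by linarith, by linarith, by linarith,
    triangleForm_nonpos hform (by gcongr) (by gcongr) (by gcongr) k3 k1 k2 l1 l2 l3⟩

/-- The least energy of a function on a segment of length `s` with end values `α`, `β`. -/
noncomputable def segEnergy (α β s : ℝ) : ℝ :=
  (β - α) ^ 2 / (2 * s) - s * (α + β) / 2 - s ^ 3 / 24

theorem segEnergy_comm (α β s : ℝ) : segEnergy α β s = segEnergy β α s := by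
  unfold segEnergy; ring

@[simp] theorem segEnergy_zero (α : ℝ) : segEnergy α α 0 = 0 := by
  simp [segEnergy]

theorem segEnergy_add_le {α β γ s t : ℝ} (hs : 0 ≤ s) (ht : 0 ≤ t) (hs' : s = 0 → α = β)
    (ht' : t = 0 → β = γ) : segEnergy α γ (s + t) ≤ segEnergy α β s + segEnergy β γ t := by
  rcases hs.eq_or_lt with rfl | hs
  · simp [hs' rfl]
  rcases ht.eq_or_lt with rfl | ht
  · simp [ht' rfl]
  have h : segEnergy α β s + segEnergy β γ t - segEnergy α γ (s + t) =
      (s + t) / (2 * s * t) * (β - (t * α + s * γ) / (s + t) - s * t / 2) ^ 2 := by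
    unfold segEnergy
    field_simp
    ring
  have : 0 ≤ (s + t) / (2 * s * t) * (β - (t * α + s * γ) / (s + t) - s * t / 2) ^ 2 := by
    positivity
  linarith

/-- Attaching an edge of length `e` to a region of length `r` still to be explored. -/
theorem segEnergy_grow {α β m e r : ℝ} (hα : α ≤ m) (he : 0 < e) (hr : 0 ≤ r) :
    -(r + e) * m - (r + e) ^ 3 / 6 ≤ segEnergy α β e - r * max m β - r ^ 3 / 6 := by
  have hsq : -(e * (e / 2 + r) ^ 2 / 2) ≤ (β - α) ^ 2 / (2 * e) - (β - α) * (e / 2 + r) := by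
    have : (β - α) ^ 2 / (2 * e) - (β - α) * (e / 2 + r) + e * (e / 2 + r) ^ 2 / 2 =
        (β - α - e * (e / 2 + r)) ^ 2 / (2 * e) := by
      field_simp; ring
    have : 0 ≤ (β - α - e * (e / 2 + r)) ^ 2 / (2 * e) := by positivity
    linarith
  rcases le_total β m with h | h
  · rw [max_eq_left h]
    have h0 : 0 ≤ (β - α) ^ 2 / (2 * e) := by positivity
    have h1 : e * (α + β) / 2 ≤ e * m := by nlinarith
    have h2 : 0 ≤ r * e * (r + e) := by positivity
    have h3 : 0 ≤ e ^ 3 := by positivity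
    unfold segEnergy
    nlinarith
  · rw [max_eq_right h]
    have h1 := mul_le_mul_of_nonneg_left hα (show 0 ≤ r + e by positivity)
    unfold segEnergy
    nlinarith

theorem neg_starF_le {a b c : ℝ} (ha : 0 < a) (hb : 0 < b) (hc : 0 < c) (h : ℝ) :
    -starF a b c ≤ segEnergy h 0 a + segEnergy h 0 b + segEnergy h 0 c := by
  have e : segEnergy h 0 a + segEnergy h 0 b + segEnergy h 0 c + starF a b c =
      (1 / a + 1 / b + 1 / c) / 2 *
        (h - (a + b + c) / (2 * (1 / a + 1 / b + 1 / c))) ^ 2 := by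
    have hS : 1 / a + 1 / b + 1 / c ≠ 0 := by positivity
    have : segEnergy h 0 a + segEnergy h 0 b + segEnergy h 0 c =
        h ^ 2 / 2 * (1 / a + 1 / b + 1 / c) - (a + b + c) * h / 2
          - (a ^ 3 + b ^ 3 + c ^ 3) / 24 := by
      unfold segEnergy; field_simp; ring
    rw [this, starF]
    generalize 1 / a + 1 / b + 1 / c = S at hS ⊢
    field_simp
    ring
  have : 0 ≤ (1 / a + 1 / b + 1 / c) / 2 *
        (h - (a + b + c) / (2 * (1 / a + 1 / b + 1 / c))) ^ 2 := by positivity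
  linarith

theorem segEnergy_star_eq {a b c : ℝ} (ha : 0 < a) (hb : 0 < b) (hc : 0 < c) :
    segEnergy ((a + b + c) / (2 * (1 / a + 1 / b + 1 / c))) 0 a +
      segEnergy ((a + b + c) / (2 * (1 / a + 1 / b + 1 / c))) 0 b +
      segEnergy ((a + b + c) / (2 * (1 / a + 1 / b + 1 / c))) 0 c = -starF a b c := by
  have hS : 1 / a + 1 / b + 1 / c ≠ 0 := by positivity
  have : ∀ h, segEnergy h 0 a + segEnergy h 0 b + segEnergy h 0 c =
      h ^ 2 / 2 * (1 / a + 1 / b + 1 / c) - (a + b + c) * h / 2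
        - (a ^ 3 + b ^ 3 + c ^ 3) / 24 := by
    intro h; unfold segEnergy; field_simp; ring
  rw [this, starF]
  generalize 1 / a + 1 / b + 1 / c = S at hS ⊢
  field_simp
  ring

/-- Spreading length `δ` over a point of value `M` of a segment. -/
theorem segEnergy_insert {α M β s t δ : ℝ} (hs : 0 ≤ s) (ht : 0 ≤ t) (hδ : 0 ≤ δ)
    (hs' : s = 0 → α = M) (ht' : t = 0 → M = β) :
    segEnergy α β (s + t + δ) - δ ^ 3 / 8 ≤
      segEnergy α M s + segEnergy M β t - δ * M - δ ^ 3 / 6 := by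
  have h1 := segEnergy_add_le (γ := M) hs hδ hs' (fun _ => rfl)
  have h2 := segEnergy_add_le (α := α) (add_nonneg hs hδ) ht
    (fun h => hs' (by linarith)) ht'
  have h3 : segEnergy M M δ = -(δ * M) - δ ^ 3 / 24 := by
    simp [segEnergy]; ring
  rw [show s + t + δ = s + δ + t by ring]
  linarith

theorem starF_truncate_lt {s t b c : ℝ} (hs : 0 < s) (ht : 0 < t) (hb : 0 < b) (hc : 0 < c) :
    starF t b c + s ^ 3 / 24 < starF (s + t) b c := by
  have h1 : 0 < s * t * (s + t) := by positivity
  have h2 : (t + b + c) ^ 2 / (8 * (1 / t + 1 / b + 1 / c)) ≤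
      (s + t + b + c) ^ 2 / (8 * (1 / (s + t) + 1 / b + 1 / c)) := by
    gcongr <;> linarith
  unfold starF
  nlinarith

theorem cubes_lt_starF {a b c : ℝ} (ha : 0 < a) (hb : 0 < b) (hc : 0 < c) :
    (a ^ 3 + b ^ 3 + c ^ 3) / 24 < starF a b c := by
  unfold starF
  have : 0 < (a + b + c) ^ 2 / (8 * (1 / a + 1 / b + 1 / c)) := by positivity
  linarith

theorem integral_primitive {g : ℝ → ℝ} {L : ℝ} (hg : IntervalIntegrable g volume 0 L) :
    ∫ x in (0 : ℝ)..L, (∫ t in (0 : ℝ)..x, g t) = ∫ t in (0 : ℝ)..L, (L - t) * g t := by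
  have hG := hg.absolutelyContinuousOnInterval_intervalIntegral (c := 0) (by simp)
  have hw : AbsolutelyContinuousOnInterval (fun x : ℝ => x - L) 0 L :=
    ContDiffOn.absolutelyContinuousOnInterval (by fun_prop)
  have h := hG.integral_mul_deriv_eq_deriv_mul hw
  have hd : ∀ x : ℝ, deriv (fun x : ℝ => x - L) x = 1 := by intro x; simp
  simp only [hd, mul_one, sub_self, mul_zero, intervalIntegral.integral_same, zero_mul,
    zero_sub] at h
  rw [h, ← intervalIntegral.integral_neg]
  apply intervalIntegral.integral_congr_ae
  filter_upwards [hg.ae_hasDerivAt_integral] with x hx hx'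
  rw [(hx (uIoc_subset_uIcc hx') 0 (by simp)).deriv]
  ring

theorem integral_slope (c d L : ℝ) :
    ∫ t in (0 : ℝ)..L, (c - d * t) ^ 2 = c ^ 2 * L - c * d * L ^ 2 + d ^ 2 * L ^ 3 / 3 := by
  have h : ∀ x ∈ uIcc 0 L, HasDerivAt
      (fun t => c ^ 2 * t - c * d * t ^ 2 + d ^ 2 * t ^ 3 / 3) ((c - d * x) ^ 2) x := by
    intro x _
    refine HasDerivAt.congr_deriv ((((hasDerivAt_id x).const_mul (c ^ 2)).sub
      ((hasDerivAt_pow 2 x).const_mul (c * d))).add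
      (((hasDerivAt_pow 3 x).const_mul (d ^ 2)).div_const 3)) ?_
    simp; ring
  rw [intervalIntegral.integral_eq_sub_of_hasDerivAt h
    (by apply Continuous.intervalIntegrable; fun_prop)]
  ring

/-- Among `H¹` functions on a segment with given end values, the energy is at least
`segEnergy`. -/
theorem segEnergy_le {f g : ℝ → ℝ} {L : ℝ} (hL : 0 < L) (hg : IntegrableOn g (Icc 0 L))
    (hg2 : IntegrableOn (fun t => g t ^ 2) (Icc 0 L))
    (hf : ∀ x ∈ Icc (0 : ℝ) L, f x = f 0 + ∫ t in (0 : ℝ)..x, g t) :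
    segEnergy (f 0) (f L) L ≤
      1 / 2 * (∫ x in (0 : ℝ)..L, g x ^ 2) - ∫ x in (0 : ℝ)..L, f x := by
  have hgi : IntervalIntegrable g volume 0 L :=
    (intervalIntegrable_iff_integrableOn_Icc_of_le hL.le).2 hg
  have hg2i : IntervalIntegrable (fun t => g t ^ 2) volume 0 L :=
    (intervalIntegrable_iff_integrableOn_Icc_of_le hL.le).2 hg2
  have hG := hgi.absolutelyContinuousOnInterval_intervalIntegral (c := 0) (by simp)
  have hfi : ∫ x in (0 : ℝ)..L, f x = L * f 0 + ∫ t in (0 : ℝ)..L, (L - t) * g t := by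
    rw [← integral_primitive hgi, intervalIntegral.integral_congr (g := fun x =>
      f 0 + ∫ t in (0 : ℝ)..x, g t) (fun x hx => hf x (by rwa [uIcc_of_le hL.le] at hx)),
      intervalIntegral.integral_add (by simp) hG.continuousOn.intervalIntegrable]
    simp
  have hend : ∫ t in (0 : ℝ)..L, g t = f L - f 0 := by
    rw [hf L (right_mem_Icc.2 hL.le)]; ring
  set c := (f L - f 0) / L + L / 2 with hc
  have hr : ∫ t in (0 : ℝ)..L, (g t - (c - 1 * t)) ^ 2 =
      (∫ t in (0 : ℝ)..L, g t ^ 2) - 2 * (c - L) * (∫ t in (0 : ℝ)..L, g t)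
        - 2 * (∫ t in (0 : ℝ)..L, (L - t) * g t) + ∫ t in (0 : ℝ)..L, (c - 1 * t) ^ 2 := by
    have hmul : IntervalIntegrable (fun t => (L - t) * g t) volume 0 L :=
      hgi.continuousOn_mul (by fun_prop)
    rw [← intervalIntegral.integral_const_mul, ← intervalIntegral.integral_const_mul,
      ← intervalIntegral.integral_sub hg2i (hgi.const_mul _),
      ← intervalIntegral.integral_sub (hg2i.sub (hgi.const_mul _)) (hmul.const_mul _),
      ← intervalIntegral.integral_add ((hg2i.sub (hgi.const_mul _)).sub (hmul.const_mul _))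
        (by apply Continuous.intervalIntegrable; fun_prop)]
    apply intervalIntegral.integral_congr
    intro t _
    ring
  have hpos : 0 ≤ ∫ t in (0 : ℝ)..L, (g t - (c - 1 * t)) ^ 2 :=
    intervalIntegral.integral_nonneg hL.le fun t _ => sq_nonneg _
  rw [hr, integral_slope, hend] at hpos
  rw [hfi]
  have key : segEnergy (f 0) (f L) L = (c - L) * (f L - f 0) - L * f 0
      - (c ^ 2 * L - c * 1 * L ^ 2 + 1 ^ 2 * L ^ 3 / 3) / 2 := by
    rw [hc]; unfold segEnergy
    field_simp
    ring
  rw [key]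
  linarith

namespace MetricGraph

variable (G : MetricGraph)

/-- The underlying combinatorial graph. -/
def toSimple : SimpleGraph (Fin G.N) where
  Adj := G.edge
  symm := ⟨G.edge_symm⟩
  loopless := ⟨G.edge_irrefl⟩

@[simp] theorem toSimple_adj {i j : Fin G.N} : G.toSimple.Adj i j ↔ G.edge i j := Iff.rfl

open scoped Classical in
/-- The finite set of (undirected) edges. -/
noncomputable def edges : Finset (Sym2 (Fin G.N)) :=
  Finset.univ.filter (· ∈ G.toSimple.edgeSet)

@[simp] theorem mem_edges {e : Sym2 (Fin G.N)} : e ∈ G.edges ↔ e ∈ G.toSimple.edgeSet := by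
  simp [edges]

/-- The length of an unordered pair of vertices. -/
def edgeLen : Sym2 (Fin G.N) → ℝ := Sym2.lift ⟨G.len, G.len_symm⟩

/-- The energy of an edge on which the end values are given by `U`. -/
noncomputable def edgeEnergy (U : Fin G.N → ℝ) : Sym2 (Fin G.N) → ℝ :=
  Sym2.lift ⟨fun i j => segEnergy (U i) (U j) (G.len i j), fun i j => by
    dsimp only; rw [segEnergy_comm, G.len_symm]⟩

@[simp] theorem edgeLen_mk (i j : Fin G.N) : G.edgeLen s(i, j) = G.len i j := rfl

@[simp] theorem edgeEnergy_mk (U : Fin G.N → ℝ) (i j : Fin G.N) :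
    G.edgeEnergy U s(i, j) = segEnergy (U i) (U j) (G.len i j) := rfl

theorem edgeLen_pos {e : Sym2 (Fin G.N)} (he : e ∈ G.toSimple.edgeSet) : 0 < G.edgeLen e := by
  induction e with
  | _ i j => exact G.len_pos i j he

open scoped Classical in
theorem sum_edges (F : Sym2 (Fin G.N) → ℝ) :
    ∑ i : Fin G.N, ∑ j : Fin G.N, (if i < j ∧ G.edge i j then F s(i, j) else 0) =
      ∑ e ∈ G.edges, F e := by
  rw [← Finset.sum_product', ← Finset.sum_filter]
  refine Finset.sum_nbij (fun p => s(p.1, p.2)) ?_ ?_ ?_ (fun _ _ => rfl)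
  · rintro ⟨i, j⟩ h
    simpa using (by simpa using h : i < j ∧ G.edge i j).2
  · rintro ⟨i, j⟩ h ⟨i', j'⟩ h' he
    have h1 : i < j ∧ G.edge i j := by simpa using h
    have h2 : i' < j' ∧ G.edge i' j' := by simpa using h'
    rcases Sym2.eq_iff.1 he with ⟨rfl, rfl⟩ | ⟨rfl, rfl⟩
    · rfl
    · exact absurd h1.1 h2.1.asymm
  · intro e he
    have he : e ∈ G.toSimple.edgeSet := by simpa using he
    induction e with
    | _ i j =>
      rw [SimpleGraph.mem_edgeSet] at he
      rcases lt_or_gt_of_ne he.ne with h | h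
      · exact ⟨(i, j), by simpa using ⟨h, he⟩, rfl⟩
      · exact ⟨(j, i), by simpa using ⟨h, he.symm⟩, Sym2.eq_swap⟩

theorem totalLength_eq : G.totalLength = ∑ e ∈ G.edges, G.edgeLen e := by
  rw [← sum_edges]; rfl

variable {G}

theorem Connected.toSimple (h : G.Connected) : G.toSimple.Connected := by
  have : Nonempty (Fin G.N) := ⟨⟨0, h.1⟩⟩
  refine ⟨fun i j => ?_⟩
  induction h.2 i j with
  | refl => exact SimpleGraph.Reachable.refl _
  | tail _ h ih => exact ih.trans (SimpleGraph.Adj.reachable h)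

theorem exists_edge_out {W : Set (Fin G.N)} (hc : G.Connected) (hW : W.Nonempty)
    (hW' : W ≠ univ) : ∃ w ∈ W, ∃ v ∉ W, G.edge w v := by
  obtain ⟨w, hw⟩ := hW
  obtain ⟨v, hv⟩ := (ne_univ_iff_exists_notMem W).1 hW'
  by_contra! h
  refine hv ?_
  clear hv
  induction hc.2 w v with
  | refl => exact hw
  | tail _ he ih => by_contra h'; exact h _ ih _ h' he

/-- The energy of the edges outside of an explored region on which `U ≤ m`. -/
theorem sum_edgeEnergy_ge (hc : G.Connected) (U : Fin G.N → ℝ) {R : Finset (Sym2 (Fin G.N))}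
    {W : Set (Fin G.N)} {m : ℝ} (hW : W.Nonempty) (hR : R ⊆ G.edges)
    (hRW : ∀ e ∈ G.edges, e ∉ R → ∀ v ∈ e, v ∈ W) (hU : ∀ w ∈ W, U w ≤ m) :
    -(∑ e ∈ R, G.edgeLen e) * m - (∑ e ∈ R, G.edgeLen e) ^ 3 / 6 ≤
      ∑ e ∈ R, G.edgeEnergy U e := by
  classical
  induction R using Finset.strongInduction generalizing W m with
  | H R ih =>
    rcases R.eq_empty_or_nonempty with rfl | hne
    · simp
    obtain ⟨w, hw, v, he⟩ : ∃ w ∈ W, ∃ v, s(w, v) ∈ R := by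
      by_cases hWu : W = univ
      · obtain ⟨e, he⟩ := hne
        induction e with
        | _ i j => exact ⟨i, by simp [hWu], j, he⟩
      · obtain ⟨w, hw, v, hv, he⟩ := exists_edge_out hc hW hWu
        exact ⟨w, hw, v, by_contra fun h => hv (hRW _ (by simpa using he) h v (by simp))⟩
    have hpos := G.edgeLen_pos ((G.mem_edges).1 (hR he))
    have := ih (R.erase s(w, v)) (Finset.erase_ssubset he) (W := insert v W) (m := max m (U v))
      (insert_nonempty _ _) ((Finset.erase_subset _ _).trans hR)
      (by
        intro e' he' hne' x hx
        by_cases h : e' = s(w, v)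
        · subst h
          rcases Sym2.mem_iff.1 hx with rfl | rfl <;> simp [hw]
        · exact Or.inr (hRW e' he' (fun h' => hne' (Finset.mem_erase.2 ⟨h, h'⟩)) x hx))
      (by
        rintro x (rfl | hx)
        · exact le_max_right _ _
        · exact (hU x hx).trans (le_max_left _ _))
    rw [← Finset.sum_erase_add _ _ he, ← Finset.sum_erase_add _ _ he]
    have h0 : 0 ≤ ∑ e ∈ R.erase s(w, v), G.edgeLen e := Finset.sum_nonneg fun e he =>
      (G.edgeLen_pos ((G.mem_edges).1 (hR (Finset.mem_of_mem_erase he)))).le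
    have hg := segEnergy_grow (β := U v) (hU w hw) hpos h0
    simp only [edgeLen_mk, edgeEnergy_mk] at hg ⊢
    linarith

/-- The length of a walk. -/
def walkLen {i j : Fin G.N} (p : G.toSimple.Walk i j) : ℝ := (p.edges.map G.edgeLen).sum

/-- The energy of a walk. -/
noncomputable def walkEnergy (U : Fin G.N → ℝ) {i j : Fin G.N} (p : G.toSimple.Walk i j) : ℝ :=
  (p.edges.map (G.edgeEnergy U)).sum

section Walk

variable {i j k : Fin G.N}

@[simp] theorem walkLen_append (p : G.toSimple.Walk i j) (q : G.toSimple.Walk j k) :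
    walkLen (p.append q) = walkLen p + walkLen q := by
  simp [walkLen]

@[simp] theorem walkEnergy_append (U : Fin G.N → ℝ) (p : G.toSimple.Walk i j)
    (q : G.toSimple.Walk j k) :
    walkEnergy U (p.append q) = walkEnergy U p + walkEnergy U q := by
  simp [walkEnergy]

theorem walkLen_nonneg (p : G.toSimple.Walk i j) : 0 ≤ walkLen p := by
  refine List.sum_nonneg fun x hx => ?_
  obtain ⟨e, he, rfl⟩ := List.mem_map.1 hx
  exact (G.edgeLen_pos (p.edges_subset_edgeSet he)).le

theorem walkLen_pos (p : G.toSimple.Walk i j) (h : i ≠ j) : 0 < walkLen p := by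
  cases p with
  | nil => exact absurd rfl h
  | cons ha q =>
    have := walkLen_nonneg q
    have h2 := G.len_pos _ _ ha
    simp only [walkLen, SimpleGraph.Walk.edges_cons, List.map_cons, List.sum_cons,
      edgeLen_mk] at this ⊢
    linarith

theorem segEnergy_le_walkEnergy (U : Fin G.N → ℝ) (p : G.toSimple.Walk i j) :
    segEnergy (U i) (U j) (walkLen p) ≤ walkEnergy U p := by
  induction p with
  | nil => simp [walkLen, walkEnergy]
  | @cons u v w ha q ih =>
    have h2 := G.len_pos _ _ ha
    have h := segEnergy_add_le (α := U u) (β := U v) (γ := U w) h2.le (walkLen_nonneg q)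
      (fun h => absurd h h2.ne') (fun h => by
        by_contra hne
        exact (walkLen_pos q (fun h => hne (by rw [h]))).ne' h)
    simp only [walkLen, walkEnergy, SimpleGraph.Walk.edges_cons, List.map_cons, List.sum_cons,
      edgeLen_mk, edgeEnergy_mk] at h ih ⊢
    linarith

theorem dist_vpos_le {d : ℕ} (γ : Immersion G d) (p : G.toSimple.Walk i j) :
    dist (γ.vpos i) (γ.vpos j) ≤ walkLen p := by
  induction p with
  | nil => simp [walkLen]
  | @cons u v w ha q ih =>
    have h2 := G.len_pos _ _ ha
    have hend : γ.toFun u v (G.len u v) = γ.vpos v := by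
      rw [← γ.start v u (G.edge_symm _ _ ha), γ.symm u v ha, sub_zero]
    have h1 : dist (γ.vpos u) (γ.vpos v) ≤ G.len u v := by
      have h := eVariationOn.edist_le (γ.toFun u v) (left_mem_Icc.2 h2.le) (right_mem_Icc.2 h2.le)
      rw [γ.arclen u v ha 0 _ le_rfl h2.le le_rfl, γ.start u v ha, hend, sub_zero,
        edist_dist] at h
      exact (ENNReal.ofReal_le_ofReal_iff h2.le).1 h
    have := dist_triangle (γ.vpos u) (γ.vpos v) (γ.vpos w)
    simp only [walkLen, SimpleGraph.Walk.edges_cons, List.map_cons, List.sum_cons,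
      edgeLen_mk] at ih ⊢
    linarith

end Walk

end MetricGraph

/-- Three paths from a common vertex which are otherwise disjoint. -/
structure Tripod {V : Type*} (g : SimpleGraph V) (i j k : V) where
  c : V
  p : g.Walk c i
  q : g.Walk c j
  r : g.Walk c k
  hp : p.IsPath
  hq : q.IsPath
  hr : r.IsPath
  hpq : ∀ v ∈ p.support, v ∈ q.support → v = c
  hqr : ∀ v ∈ q.support, v ∈ r.support → v = c
  hrp : ∀ v ∈ r.support, v ∈ p.support → v = c

namespace Tripod

variable {V : Type*} {g : SimpleGraph V} {i j k : V}

/-- Cyclic permutation of the arms. -/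
def rotate (T : Tripod g i j k) : Tripod g j k i :=
  ⟨T.c, T.q, T.r, T.p, T.hq, T.hr, T.hp, T.hqr, T.hrp, T.hpq⟩

theorem disjoint_edges {c : V} {p : g.Walk c i} {q : g.Walk c j}
    (h : ∀ v ∈ p.support, v ∈ q.support → v = c) : p.edges.Disjoint q.edges := by
  intro e he he'
  induction e with
  | _ x y =>
    have hx := h x (p.fst_mem_support_of_mem_edges he) (q.fst_mem_support_of_mem_edges he')
    have hy := h y (p.snd_mem_support_of_mem_edges he) (q.snd_mem_support_of_mem_edges he')
    exact (p.adj_of_mem_edges he).ne (hx.trans hy.symm)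

theorem nodup_edges (T : Tripod g i j k) : (T.p.edges ++ T.q.edges ++ T.r.edges).Nodup := by
  rw [List.nodup_append', List.nodup_append', List.disjoint_append_left]
  exact ⟨⟨T.hp.isTrail.edges_nodup, T.hq.isTrail.edges_nodup, disjoint_edges T.hpq⟩,
    T.hr.isTrail.edges_nodup, (disjoint_edges T.hrp).symm, disjoint_edges T.hqr⟩

open scoped Classical in
/-- The edges of a tripod. -/
noncomputable def edges (T : Tripod g i j k) : Finset (Sym2 V) :=
  (T.p.edges ++ T.q.edges ++ T.r.edges).toFinset

theorem mem_edges {T : Tripod g i j k} {e : Sym2 V} :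
    e ∈ T.edges ↔ e ∈ T.p.edges ∨ e ∈ T.q.edges ∨ e ∈ T.r.edges := by
  simp [edges]

theorem sum_edges (T : Tripod g i j k) (F : Sym2 V → ℝ) :
    ∑ e ∈ T.edges, F e =
      (T.p.edges.map F).sum + (T.q.edges.map F).sum + (T.r.edges.map F).sum := by
  classical
  rw [edges, List.sum_toFinset _ T.nodup_edges]
  simp [add_assoc]

theorem edges_rotate (T : Tripod g i j k) : T.rotate.edges = T.edges := by
  ext e
  simp only [mem_edges, rotate]
  tauto

/-- The vertices of a tripod. -/
def verts (T : Tripod g i j k) : Set V :=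
  {v | v ∈ T.p.support ∨ v ∈ T.q.support ∨ v ∈ T.r.support}

theorem mem_verts_of_mem_edges {T : Tripod g i j k} {e : Sym2 V} (he : e ∈ T.edges) {v : V}
    (hv : v ∈ e) : v ∈ T.verts := by
  rcases mem_edges.1 he with h | h | h
  · exact Or.inl (T.p.mem_support_of_mem_edges h hv)
  · exact Or.inr (Or.inl (T.q.mem_support_of_mem_edges h hv))
  · exact Or.inr (Or.inr (T.r.mem_support_of_mem_edges h hv))

theorem exists_tripod (hg : g.Connected) (i j k : V) : Nonempty (Tripod g i j k) := by
  classical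
  obtain ⟨q, hq⟩ := (hg i j).exists_isPath
  have hex : ∃ n, ∃ c ∈ q.support, ∃ r : g.Walk c k, r.IsPath ∧ r.length = n := by
    obtain ⟨r, hr⟩ := (hg i k).exists_isPath
    exact ⟨_, i, q.start_mem_support, r, hr, rfl⟩
  obtain ⟨c, hc, r, hr, hn⟩ := Nat.find_spec hex
  have hmin : ∀ v ∈ r.support, v ∈ q.support → v = c := by
    intro v hv hvq
    by_contra hne
    have hlt : (r.dropUntil v hv).length < r.length := by
      have h := congrArg SimpleGraph.Walk.length (r.take_spec hv)
      rw [SimpleGraph.Walk.length_append] at h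
      have : (r.takeUntil v hv).length ≠ 0 := fun h0 =>
        hne (SimpleGraph.Walk.eq_of_length_eq_zero h0).symm
      omega
    exact Nat.find_min hex (hn ▸ hlt) ⟨v, hvq, _, hr.dropUntil hv, rfl⟩
  have hsup : ∀ v ∈ (q.takeUntil c hc).support, v ∈ (q.dropUntil c hc).support → v = c := by
    intro v h1 h2
    have hnd := hq.support_nodup
    rw [← q.take_spec hc, SimpleGraph.Walk.support_append, List.nodup_append'] at hnd
    rw [SimpleGraph.Walk.mem_support_iff] at h2
    exact h2.resolve_right fun h => hnd.2.2 h1 h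
  exact ⟨⟨c, (q.takeUntil c hc).reverse, q.dropUntil c hc, r, (hq.takeUntil hc).reverse,
    hq.dropUntil hc, hr, by simpa using hsup,
    fun v h1 h2 => hmin v h2 (q.support_dropUntil_subset_support hc h1),
    fun v h1 h2 => hmin v h1 (q.support_takeUntil_subset_support hc (by simpa using h2))⟩⟩

end Tripod

namespace MetricGraph

variable {G : MetricGraph} {i j k : Fin G.N}

theorem tripod_edges_subset (T : Tripod G.toSimple i j k) : T.edges ⊆ G.edges := by
  intro e he
  rw [mem_edges]
  rcases Tripod.mem_edges.1 he with h | h | h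
  exacts [T.p.edges_subset_edgeSet h, T.q.edges_subset_edgeSet h, T.r.edges_subset_edgeSet h]

open scoped Classical in
theorem sum_edges_eq_tripod (T : Tripod G.toSimple i j k) (F : Sym2 (Fin G.N) → ℝ) :
    ∑ e ∈ G.edges, F e = (T.p.edges.map F).sum + (T.q.edges.map F).sum +
      (T.r.edges.map F).sum + ∑ e ∈ G.edges \ T.edges, F e := by
  rw [← Finset.sum_sdiff (tripod_edges_subset T), Tripod.sum_edges]
  ring

open scoped Classical in
theorem totalLength_eq_tripod (T : Tripod G.toSimple i j k) :
    G.totalLength = walkLen T.p + walkLen T.q + walkLen T.r +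
      ∑ e ∈ G.edges \ T.edges, G.edgeLen e := by
  rw [totalLength_eq, sum_edges_eq_tripod T]; rfl

theorem segEnergy_split_le {c : Fin G.N} (U : Fin G.N → ℝ) (p : G.toSimple.Walk c i)
    {v : Fin G.N} (hv : v ∈ p.support) {δ : ℝ} (hδ : 0 ≤ δ) :
    segEnergy (U c) (U i) (walkLen p + δ) - δ ^ 3 / 8 ≤
      walkEnergy U p - δ * U v - δ ^ 3 / 6 := by
  obtain ⟨q, r, rfl⟩ := SimpleGraph.Walk.mem_support_iff_exists_append.1 hv
  have h := segEnergy_insert (walkLen_nonneg q) (walkLen_nonneg r) hδ (α := U c) (β := U i)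
    (M := U v)
    (fun h => by_contra fun hne => (walkLen_pos q (fun h => hne (by rw [h]))).ne' h)
    (fun h => by_contra fun hne => (walkLen_pos r (fun h => hne (by rw [h]))).ne' h)
  have h1 := segEnergy_le_walkEnergy U q
  have h2 := segEnergy_le_walkEnergy U r
  simp only [walkLen_append, walkEnergy_append]
  linarith

theorem tripod_excess_nonneg (T : Tripod G.toSimple i j k) {δ : ℝ}
    (hδ : G.totalLength = walkLen T.p + walkLen T.q + walkLen T.r + δ) : 0 ≤ δ := by
  classical
  rw [totalLength_eq_tripod T] at hδ
  have : 0 ≤ ∑ e ∈ G.edges \ T.edges, G.edgeLen e := Finset.sum_nonneg fun e he =>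
    (G.edgeLen_pos ((G.mem_edges).1 (Finset.mem_sdiff.1 he).1)).le
  linarith

theorem sum_edgeEnergy_ge_of_max (hc : G.Connected) (T : Tripod G.toSimple i j k)
    (hp : 0 < walkLen T.p) (hq : 0 < walkLen T.q) (hr : 0 < walkLen T.r)
    {U : Fin G.N → ℝ} (hi : U i = 0) (hj : U j = 0) (hk : U k = 0) {δ : ℝ}
    (hδ : G.totalLength = walkLen T.p + walkLen T.q + walkLen T.r + δ)
    {v : Fin G.N} (hv : v ∈ T.p.support) (hmax : ∀ w ∈ T.verts, U w ≤ U v) :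
    -(starF (walkLen T.p + δ) (walkLen T.q) (walkLen T.r) + δ ^ 3 / 8) ≤
      ∑ e ∈ G.edges, G.edgeEnergy U e := by
  classical
  have h0 := tripod_excess_nonneg T hδ
  rw [totalLength_eq_tripod T] at hδ
  have hδ' : ∑ e ∈ G.edges \ T.edges, G.edgeLen e = δ := by linarith
  have hx := sum_edgeEnergy_ge hc U (R := G.edges \ T.edges) (W := T.verts)
    ⟨T.c, Or.inl T.p.start_mem_support⟩ Finset.sdiff_subset
    (fun e he he' v hv => Tripod.mem_verts_of_mem_edges (T := T)
      (by_contra fun h => he' (Finset.mem_sdiff.2 ⟨he, h⟩)) hv) hmax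
  rw [hδ'] at hx
  have h1 := segEnergy_split_le U T.p hv h0
  have h2 := segEnergy_le_walkEnergy U T.q
  have h3 := segEnergy_le_walkEnergy U T.r
  rw [hi] at h1
  rw [hj] at h2
  rw [hk] at h3
  have h4 := neg_starF_le (add_pos_of_pos_of_nonneg hp h0) hq hr (U T.c)
  rw [sum_edges_eq_tripod T]
  unfold walkEnergy at h1 h2 h3
  linarith

/-- The energy of a graph containing a tripod with arms `a`, `b`, `c` and with excess length
`δ` is bounded by that of a star with `δ` added to one of its arms. -/
theorem neg_le_sum_edgeEnergy (hc : G.Connected) (T : Tripod G.toSimple i j k)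
    (hp : 0 < walkLen T.p) (hq : 0 < walkLen T.q) (hr : 0 < walkLen T.r)
    {U : Fin G.N → ℝ} (hi : U i = 0) (hj : U j = 0) (hk : U k = 0) {δ F : ℝ}
    (hδ : G.totalLength = walkLen T.p + walkLen T.q + walkLen T.r + δ)
    (h1 : starF (walkLen T.p + δ) (walkLen T.q) (walkLen T.r) + δ ^ 3 / 8 ≤ F)
    (h2 : starF (walkLen T.q + δ) (walkLen T.r) (walkLen T.p) + δ ^ 3 / 8 ≤ F)
    (h3 : starF (walkLen T.r + δ) (walkLen T.p) (walkLen T.q) + δ ^ 3 / 8 ≤ F) :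
    -F ≤ ∑ e ∈ G.edges, G.edgeEnergy U e := by
  obtain ⟨v, hv, hmax⟩ := Set.exists_max_image T.verts U (Set.toFinite _)
    ⟨T.c, Or.inl T.p.start_mem_support⟩
  rcases hv with hv | hv | hv
  · exact (neg_le_neg h1).trans (sum_edgeEnergy_ge_of_max hc T hp hq hr hi hj hk hδ hv hmax)
  · exact (neg_le_neg h2).trans (sum_edgeEnergy_ge_of_max hc T.rotate hq hr hp hj hk hi
      (by rw [hδ]; simp only [Tripod.rotate]; ring) hv
      (fun w hw => hmax w (by simp only [Tripod.verts, Tripod.rotate, mem_ofPred_eq] at hw ⊢; tauto)))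
  · exact (neg_le_neg h3).trans (sum_edgeEnergy_ge_of_max hc T.rotate.rotate hr hp hq hk hi hj
      (by rw [hδ]; simp only [Tripod.rotate]; ring) hv
      (fun w hw => hmax w (by simp only [Tripod.verts, Tripod.rotate, mem_ofPred_eq] at hw ⊢; tauto)))

theorem tripod_energy_eq (T : Tripod G.toSimple i j k) (hR : G.edges ⊆ T.edges)
    (U : Fin G.N → ℝ) : walkEnergy U T.p + walkEnergy U T.q + walkEnergy U T.r =
      ∑ e ∈ G.edges, G.edgeEnergy U e := by
  classical
  rw [sum_edges_eq_tripod T, Finset.sdiff_eq_empty_iff_subset.2 hR]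
  simp [walkEnergy]

theorem segEnergy_zero_zero (s : ℝ) : segEnergy 0 0 s = -(s ^ 3 / 24) := by
  simp [segEnergy]

/-- If `U` is required to vanish inside an arm of a tripod, the star bound is not attained. -/
theorem interior_zero_bound (T : Tripod G.toSimple i j k) (hR : G.edges ⊆ T.edges)
    (hq : 0 < walkLen T.q) (hr : 0 < walkLen T.r) {v : Fin G.N} (hv : v ∈ T.p.support)
    (hvc : v ≠ T.c) (hvi : v ≠ i) : ∃ F < starF (walkLen T.p) (walkLen T.q) (walkLen T.r),
      ∀ U : Fin G.N → ℝ, U i = 0 → U j = 0 → U k = 0 → U v = 0 →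
        -F ≤ ∑ e ∈ G.edges, G.edgeEnergy U e := by
  obtain ⟨p₁, p₂, hp⟩ := SimpleGraph.Walk.mem_support_iff_exists_append.1 hv
  have h1 := walkLen_pos p₁ hvc.symm
  have h2 := walkLen_pos p₂ hvi
  refine ⟨starF (walkLen p₁) (walkLen T.q) (walkLen T.r) + walkLen p₂ ^ 3 / 24, ?_, ?_⟩
  · rw [hp, walkLen_append, add_comm (walkLen p₁)]
    exact starF_truncate_lt h2 h1 hq hr
  · intro U hi hj hk hv
    have e1 := segEnergy_le_walkEnergy U p₁
    have e2 := segEnergy_le_walkEnergy U p₂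
    have e3 := segEnergy_le_walkEnergy U T.q
    have e4 := segEnergy_le_walkEnergy U T.r
    have e5 := neg_starF_le h1 hq hr (U T.c)
    rw [hv] at e1
    rw [hv, hi, segEnergy_zero_zero] at e2
    rw [hj] at e3
    rw [hk] at e4
    rw [← tripod_energy_eq T hR, hp, walkEnergy_append]
    linarith

/-- If `U` is required to vanish at the center of a tripod, the star bound is not attained. -/
theorem center_zero_bound (T : Tripod G.toSimple i j k) (hR : G.edges ⊆ T.edges)
    (hp : 0 < walkLen T.p) (hq : 0 < walkLen T.q) (hr : 0 < walkLen T.r) :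
    ∃ F < starF (walkLen T.p) (walkLen T.q) (walkLen T.r),
      ∀ U : Fin G.N → ℝ, U i = 0 → U j = 0 → U k = 0 → U T.c = 0 →
        -F ≤ ∑ e ∈ G.edges, G.edgeEnergy U e := by
  refine ⟨_, cubes_lt_starF hp hq hr, fun U hi hj hk hv => ?_⟩
  have e1 := segEnergy_le_walkEnergy U T.p
  have e2 := segEnergy_le_walkEnergy U T.q
  have e3 := segEnergy_le_walkEnergy U T.r
  rw [hv, hi, segEnergy_zero_zero] at e1
  rw [hv, hj, segEnergy_zero_zero] at e2
  rw [hv, hk, segEnergy_zero_zero] at e3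
  rw [← tripod_energy_eq T hR]
  linarith

/-- The value at a vertex of a function on a metric graph. -/
noncomputable def vertexValue (u : H1Fun G) (i : Fin G.N) : ℝ :=
  open scoped Classical in if h : ∃ j, G.edge i j then u.toFun i h.choose 0 else 0

theorem vertexValue_eq (u : H1Fun G) (h : G.edge i j) : u.toFun i j 0 = vertexValue u i := by
  have h' : ∃ j, G.edge i j := ⟨j, h⟩
  rw [vertexValue, dif_pos h']
  exact u.vertexCont i j _ h h'.choose_spec

theorem vertexValue_eq_zero {u : H1Fun G} {W : Set (Fin G.N)} (hu : u.ZeroOn W) (hi : i ∈ W) :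
    vertexValue u i = 0 := by
  unfold vertexValue
  split_ifs with h
  · exact hu i hi _ h.choose_spec
  · rfl

theorem sum_edgeEnergy_le_energyJ (u : H1Fun G) :
    ∑ e ∈ G.edges, G.edgeEnergy (vertexValue u) e ≤ energyJ G u := by
  rw [← sum_edges, energyJ]
  refine Finset.sum_le_sum fun i _ => Finset.sum_le_sum fun j _ => ?_
  split_ifs with h
  · have h2 := segEnergy_le (G.len_pos i j h.2) (u.deriv_integrable i j h.2)
      (u.deriv_sq_integrable i j h.2) (u.ftc i j h.2)
    have e : u.toFun i j (G.len i j) = vertexValue u j := by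
      rw [← vertexValue_eq u (G.edge_symm _ _ h.2), u.symm i j h.2, sub_zero]
    rwa [e, vertexValue_eq u h.2] at h2
  · rfl

/-- The zero function. -/
def zeroFun (G : MetricGraph) : H1Fun G where
  toFun _ _ _ := 0
  deriv _ _ _ := 0
  symm _ _ _ _ := rfl
  vertexCont _ _ _ _ _ := rfl
  deriv_integrable _ _ _ := by simp
  deriv_sq_integrable _ _ _ := by simp
  ftc _ _ _ _ _ := by simp

theorem le_dirEnergy {V : Set (Fin G.N)} {F : ℝ}
    (h : ∀ U : Fin G.N → ℝ, (∀ i ∈ V, U i = 0) → F ≤ ∑ e ∈ G.edges, G.edgeEnergy U e) :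
    F ≤ dirEnergy G V := by
  refine le_csInf ⟨_, zeroFun G, fun _ _ _ _ => rfl, rfl⟩ ?_
  rintro e ⟨u, hu, rfl⟩
  exact (h _ fun i hi => vertexValue_eq_zero hu hi).trans (sum_edgeEnergy_le_energyJ u)

theorem dirEnergy_le {V : Set (Fin G.N)} {F : ℝ}
    (h : ∀ U : Fin G.N → ℝ, (∀ i ∈ V, U i = 0) → F ≤ ∑ e ∈ G.edges, G.edgeEnergy U e)
    {u : H1Fun G} (hu : u.ZeroOn V) : dirEnergy G V ≤ energyJ G u := by
  refine csInf_le ⟨F, ?_⟩ ⟨u, hu, rfl⟩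
  rintro e ⟨u, hu, rfl⟩
  exact (h _ fun i hi => vertexValue_eq_zero hu hi).trans (sum_edgeEnergy_le_energyJ u)

end MetricGraph

/-- The parameters `x` and `y = √(x² - 1/4)` of the tree `Γ₁` of total length `l`. -/
structure Gamma1Param (l x y : ℝ) : Prop where
  y_nonneg : 0 ≤ y
  sq_eq : x ^ 2 = 1 / 4 + y ^ 2
  half_le : 1 / 2 ≤ x
  three_sq_le : 3 * x ^ 2 ≤ 1
  length : 2 * x + √3 / 2 - y = l
  le : l ≤ 1 + √3 / 2

namespace Gamma1Param

variable {l x y a b c δ : ℝ}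

theorem star_le (h : Gamma1Param l x y) (hT : TripodArms a b c) (hδ : 0 ≤ δ)
    (hl : l = a + b + c + δ) :
    starF (a + δ) b c + δ ^ 3 / 8 ≤ starF (√3 / 2 - y) x x ∧
      (starF (a + δ) b c + δ ^ 3 / 8 = starF (√3 / 2 - y) x x → δ = 0 ∧
        ((a = √3 / 2 - y ∧ b = x ∧ c = x) ∨ (b = √3 / 2 - y ∧ c = x ∧ a = x) ∨
          (c = √3 / 2 - y ∧ a = x ∧ b = x))) := by
  have e : a + δ - δ = a := by ring
  obtain ⟨h1, h2⟩ := star_compare (a := a + δ) (b := b) (c := c) (δ := δ) h.y_nonneg h.sq_eq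
    h.half_le h.three_sq_le (by linarith [h.length]) (by linarith [h.le]) hδ
    (by rw [e]; exact hT.ab) (by rw [e, add_comm]; exact hT.ca) hT.bc
    (by rw [e]; exact hT.fermat) (by rw [e]; exact hT.form)
  refine ⟨h1, fun h3 => ?_⟩
  obtain ⟨rfl, h4⟩ := h2 h3
  exact ⟨rfl, by simpa using h4⟩

theorem arm_pos (h : Gamma1Param l x y) (hT : TripodArms a b c) (hl : a + b + c ≤ l) :
    0 < a := by
  have h3 : √3 < 2 := by rw [Real.sqrt_lt' (by norm_num)]; norm_num
  linarith [hT.ab, hT.ca, h.le]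

end Gamma1Param

/-- The vertices of the triangle as a set. -/
noncomputable def trianglePts : Set (EuclideanSpace ℝ (Fin 2)) :=
  {pt (-√3 / 3) 0, pt (√3 / 6) (-(1 / 2)), pt (√3 / 6) (1 / 2)}

namespace MetricGraph

variable {G : MetricGraph} {i j k : Fin G.N} {l x y : ℝ}

theorem exists_tripodArms (h : Gamma1Param l x y) (hc : G.Connected) (hl : G.totalLength = l)
    (γ : Immersion G 2) {V : Set (Fin G.N)} (hV : γ.vpos '' V = trianglePts) :
    ∃ i ∈ V, ∃ j ∈ V, ∃ k ∈ V, ∃ T : Tripod G.toSimple i j k, ∃ δ, 0 ≤ δ ∧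
      l = walkLen T.p + walkLen T.q + walkLen T.r + δ ∧
      TripodArms (walkLen T.p) (walkLen T.q) (walkLen T.r) := by
  have hmem : ∀ P ∈ trianglePts, ∃ i ∈ V, γ.vpos i = P := fun P hP => by
    rwa [← hV] at hP
  obtain ⟨i, hi, hi'⟩ := hmem (pt (-√3 / 3) 0) (by simp [trianglePts])
  obtain ⟨j, hj, hj'⟩ := hmem (pt (√3 / 6) (-(1 / 2))) (by simp [trianglePts])
  obtain ⟨k, hk, hk'⟩ := hmem (pt (√3 / 6) (1 / 2)) (by simp [trianglePts])
  obtain ⟨T⟩ := Tripod.exists_tripod hc.toSimple i j k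
  have hδ : G.totalLength = walkLen T.p + walkLen T.q + walkLen T.r +
    (G.totalLength - (walkLen T.p + walkLen T.q + walkLen T.r)) := by ring
  have h0 := tripod_excess_nonneg T hδ
  refine ⟨i, hi, j, hj, k, hk, T, _, h0, hl ▸ hδ, ?_⟩
  exact tripodArms_of_dist (P := γ.vpos T.c) (hi' ▸ dist_vpos_le γ T.p)
    (hj' ▸ dist_vpos_le γ T.q) (hk' ▸ dist_vpos_le γ T.r) (by linarith [h.le])

theorem neg_starF_le_sum_edgeEnergy (h : Gamma1Param l x y) (hc : G.Connected)
    (hl : G.totalLength = l) (γ : Immersion G 2) {V : Set (Fin G.N)}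
    (hV : γ.vpos '' V = trianglePts) (U : Fin G.N → ℝ) (hU : ∀ i ∈ V, U i = 0) :
    -starF (√3 / 2 - y) x x ≤ ∑ e ∈ G.edges, G.edgeEnergy U e := by
  obtain ⟨i, hi, j, hj, k, hk, T, δ, hδ, hl', hT⟩ := exists_tripodArms h hc hl γ hV
  exact neg_le_sum_edgeEnergy hc T (h.arm_pos hT (by linarith))
    (h.arm_pos hT.rotate (by linarith)) (h.arm_pos hT.rotate.rotate (by linarith))
    (hU i hi) (hU j hj) (hU k hk) (hl.trans hl') (h.star_le hT hδ hl').1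
    (h.star_le hT.rotate hδ (by linarith)).1 (h.star_le hT.rotate.rotate hδ (by linarith)).1

theorem edges_eq_of_support_subset {V : Type*} {g : SimpleGraph V} {c i : V} (p : g.Walk c i)
    (hp : p.IsPath) (hci : c ≠ i) (h : ∀ v ∈ p.support, v = c ∨ v = i) :
    p.edges = [s(c, i)] := by
  cases p with
  | nil => exact absurd rfl hci
  | @cons _ v _ ha q =>
    rcases h v (by simp) with rfl | rfl
    · exact absurd rfl ha.ne
    · rw [SimpleGraph.Walk.cons_isPath_iff, SimpleGraph.Walk.isPath_iff_nil] at hp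
      simp [hp.1.eq_nil]

theorem degree_eq_ncard (G : MetricGraph) (v : Fin G.N) :
    G.degree v = {j | G.edge v j}.ncard := by
  classical
  rw [degree, Finset.sum_boole, Nat.cast_id, ← Set.ncard_coe_finset]
  simp

theorem degree_eq_two (T : Tripod G.toSimple i j k) (hR : G.edges ⊆ T.edges) {v : Fin G.N}
    (hv : v ∈ T.p.support) (hvc : v ≠ T.c) (hvi : v ≠ i) : G.degree v = 2 := by
  obtain ⟨n, rfl, hn⟩ := SimpleGraph.Walk.mem_support_iff_exists_getVert.1 hv
  have hn0 : n ≠ 0 := by rintro rfl; exact hvc (by simp)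
  have hn1 : n ≠ T.p.length := by rintro rfl; exact hvi (by simp)
  rw [degree_eq_ncard, ← T.hp.ncard_neighborSet_toSubgraph_internal_eq_two hn0 (by omega)]
  congr 1
  ext w
  rw [SimpleGraph.Subgraph.mem_neighborSet, ← SimpleGraph.Subgraph.mem_edgeSet,
    SimpleGraph.Walk.mem_edges_toSubgraph]
  constructor
  · intro he
    rcases Tripod.mem_edges.1 (hR (G.mem_edges.2 (G.toSimple.mem_edgeSet.2 he))) with h | h | h
    · exact h
    · exact absurd (T.hpq _ hv (T.q.fst_mem_support_of_mem_edges h)) hvc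
    · exact absurd (T.hrp _ (T.r.fst_mem_support_of_mem_edges h) hv) hvc
  · exact fun h => T.p.adj_of_mem_edges h

theorem support_subset_pair (T : Tripod G.toSimple i j k) {V : Set (Fin G.N)} (hi : i ∈ V)
    (hj : j ∈ V) (hk : k ∈ V) (hR : G.edges ⊆ T.edges)
    (hq : 0 < walkLen T.q) (hr : 0 < walkLen T.r)
    (hE : dirEnergy G V ≤ -starF (walkLen T.p) (walkLen T.q) (walkLen T.r))
    (hdeg : ∀ i, G.degree i = 2 → i ∈ V) : ∀ v ∈ T.p.support, v = T.c ∨ v = i := by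
  intro v hv
  by_contra! hne
  have hvV := hdeg v (degree_eq_two T hR hv hne.1 hne.2)
  obtain ⟨F, hF, hU⟩ := interior_zero_bound T hR hq hr hv hne.1 hne.2
  have := le_dirEnergy (V := V) (F := -F)
    fun U h => hU U (h i hi) (h j hj) (h k hk) (h v hvV)
  linarith

theorem gamma1Shape_of_tripod (h : Gamma1Param l x y) (hc : G.Connected)
    (T : Tripod G.toSimple i j k) {V : Set (Fin G.N)} (hi : i ∈ V) (hj : j ∈ V) (hk : k ∈ V)
    (hl : G.totalLength = walkLen T.p + walkLen T.q + walkLen T.r)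
    (hp : 0 < walkLen T.p) (hpy : walkLen T.p = √3 / 2 - y)
    (hqx : walkLen T.q = x) (hrx : walkLen T.r = x)
    (hE : dirEnergy G V ≤ -starF (√3 / 2 - y) x x) (hdeg : ∀ i, G.degree i = 2 → i ∈ V) :
    Gamma1Shape x G V := by
  classical
  have hx0 : 0 < x := by linarith [h.half_le]
  have hR : G.edges ⊆ T.edges := by
    rw [totalLength_eq_tripod T] at hl
    by_contra hsub
    obtain ⟨e, he⟩ := Finset.sdiff_nonempty.2 hsub
    have : 0 < ∑ e ∈ G.edges \ T.edges, G.edgeLen e := Finset.sum_pos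
      (fun e he => G.edgeLen_pos (G.mem_edges.1 (Finset.mem_sdiff.1 he).1)) ⟨e, he⟩
    linarith
  have hq : 0 < walkLen T.q := hqx ▸ hx0
  have hr : 0 < walkLen T.r := hrx ▸ hx0
  have hcV : T.c ∉ V := by
    intro hcV
    obtain ⟨F, hF, hU⟩ := center_zero_bound T hR hp hq hr
    have := le_dirEnergy (V := V) (F := -F)
      fun U h => hU U (h i hi) (h j hj) (h k hk) (h _ hcV)
    rw [hpy, hqx, hrx] at hF
    linarith
  have hci : T.c ≠ i := (ne_of_mem_of_not_mem hi hcV).symm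
  have hcj : T.c ≠ j := (ne_of_mem_of_not_mem hj hcV).symm
  have hck : T.c ≠ k := (ne_of_mem_of_not_mem hk hcV).symm
  rw [← hpy] at hE
  have hE1 : dirEnergy G V ≤ -starF (walkLen T.p) (walkLen T.q) (walkLen T.r) := by
    rwa [hqx, hrx]
  have hE2 : dirEnergy G V ≤ -starF (walkLen T.q) (walkLen T.r) (walkLen T.p) := by
    rwa [← starF_rotate]
  have hE3 : dirEnergy G V ≤ -starF (walkLen T.r) (walkLen T.p) (walkLen T.q) := by
    rwa [← starF_rotate]
  have hR2 : G.edges ⊆ T.rotate.edges := by rwa [Tripod.edges_rotate]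
  have hR3 : G.edges ⊆ T.rotate.rotate.edges := by rwa [Tripod.edges_rotate]
  have s1 := support_subset_pair T hi hj hk hR hq hr hE1 hdeg
  have s2 := support_subset_pair T.rotate hj hk hi hR2 hr hp hE2 hdeg
  have s3 := support_subset_pair T.rotate.rotate hk hi hj hR3 hp hq hE3 hdeg
  have e1 := edges_eq_of_support_subset T.p T.hp hci s1
  have e2 := edges_eq_of_support_subset T.q T.hq hcj s2
  have e3 := edges_eq_of_support_subset T.r T.hr hck s3
  have l1 : walkLen T.p = G.len T.c i := by simp [walkLen, e1]
  have l2 : walkLen T.q = G.len T.c j := by simp [walkLen, e2]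
  have l3 : walkLen T.r = G.len T.c k := by simp [walkLen, e3]
  have hij : i ≠ j := by
    rintro rfl; exact hci (T.hpq i T.p.end_mem_support T.q.end_mem_support).symm
  have hjk : j ≠ k := by
    rintro rfl; exact hcj (T.hqr j T.q.end_mem_support T.r.end_mem_support).symm
  have hki : k ≠ i := by
    rintro rfl; exact hck (T.hrp k T.r.end_mem_support T.p.end_mem_support).symm
  have hedge : ∀ a b, G.edge a b ↔ s(a, b) = s(T.c, i) ∨ s(a, b) = s(T.c, j) ∨
      s(a, b) = s(T.c, k) := by
    intro a b
    have : G.edge a b ↔ s(a, b) ∈ T.edges :=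
      ⟨fun h => hR (G.mem_edges.2 h), fun h => G.mem_edges.1 (tripod_edges_subset T h)⟩
    rw [this, Tripod.mem_edges, e1, e2, e3]
    simp
  have hall : ∀ v, v = i ∨ v = j ∨ v = k ∨ v = T.c := by
    intro v
    by_cases hv : v = T.c
    · simp [hv]
    obtain ⟨w, hw, b, -, he⟩ := exists_edge_out hc (singleton_nonempty v) (fun h => by
      have : T.c ∈ ({v} : Set (Fin G.N)) := by rw [h]; trivial
      exact hv this.symm)
    obtain rfl : w = v := hw
    simp only [hedge, Sym2.eq_iff] at he
    tauto
  refine ⟨i, j, k, T.c, hij, hki.symm, hci.symm, hjk, hcj.symm, hck.symm, ?_, ?_, ?_, ?_, ?_, ?_⟩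
  · have : (Finset.univ : Finset (Fin G.N)) = {i, j, k, T.c} := by
      ext v; simpa using hall v
    rw [← Fintype.card_fin G.N, ← Finset.card_univ, this]
    simp [hij, hki.symm, hci.symm, hjk, hcj.symm, hck.symm]
  · ext v
    constructor
    · intro hv
      rcases hall v with h | h | h | h
      · simp [h]
      · simp [h]
      · simp [h]
      · exact absurd (h ▸ hv) hcV
    · rintro (rfl | rfl | rfl) <;> assumption
  · intro a b
    rw [hedge]
    simp only [Sym2.eq_iff, Set.pair_eq_pair_iff]
    rw [or_comm (a := a = T.c ∧ b = i), or_comm (a := a = T.c ∧ b = j),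
      or_comm (a := a = T.c ∧ b = k)]
  · have : √(x ^ 2 - 1 / 4) = y := by
      rw [h.sq_eq, add_sub_cancel_left, Real.sqrt_sq h.y_nonneg]
    rw [G.len_symm, ← l1, hpy, this]
  · rw [G.len_symm, ← l2, hqx]
  · rw [G.len_symm, ← l3, hrx]

theorem gamma1Shape_of_dirEnergy_le (h : Gamma1Param l x y) (hc : G.Connected)
    (hl : G.totalLength = l) (γ : Immersion G 2) {V : Set (Fin G.N)}
    (hV : γ.vpos '' V = trianglePts) (hE : dirEnergy G V ≤ -starF (√3 / 2 - y) x x)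
    (hdeg : ∀ i, G.degree i = 2 → i ∈ V) : Gamma1Shape x G V := by
  obtain ⟨i, hi, j, hj, k, hk, T, δ, hδ, hl', hT⟩ := exists_tripodArms h hc hl γ hV
  have hp := h.arm_pos hT (by linarith)
  have hq := h.arm_pos hT.rotate (by linarith)
  have hr := h.arm_pos hT.rotate.rotate (by linarith)
  have h1 := h.star_le hT hδ hl'
  have h2 := h.star_le hT.rotate hδ (by linarith)
  have h3 := h.star_le hT.rotate.rotate hδ (by linarith)
  have hcases : δ = 0 ∧ ((walkLen T.p = √3 / 2 - y ∧ walkLen T.q = x ∧ walkLen T.r = x) ∨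
      (walkLen T.q = √3 / 2 - y ∧ walkLen T.r = x ∧ walkLen T.p = x) ∨
      (walkLen T.r = √3 / 2 - y ∧ walkLen T.p = x ∧ walkLen T.q = x)) := by
    by_contra hne
    have n1 := lt_of_le_of_ne h1.1 (fun e => hne (h1.2 e))
    have n2 := lt_of_le_of_ne h2.1 (fun e => hne ((h2.2 e).imp_right fun h => h.elim (fun h => .inr (.inl h))
      fun h => h.elim (fun h => .inr (.inr h)) .inl))
    have n3 := lt_of_le_of_ne h3.1 (fun e => hne ((h3.2 e).imp_right fun h => h.elim (fun h => .inr (.inr h))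
      fun h => h.elim .inl fun h => .inr (.inl h)))
    obtain ⟨F, hF, hF'⟩ := exists_between (max_lt n1 (max_lt n2 n3))
    simp only [max_lt_iff] at hF
    have := le_dirEnergy (V := V) (F := -F) fun U hU =>
      neg_le_sum_edgeEnergy hc T hp hq hr (hU i hi) (hU j hj) (hU k hk) (hl.trans hl')
        hF.1.le hF.2.1.le hF.2.2.le
    linarith
  obtain ⟨rfl, h4 | h4 | h4⟩ := hcases
  · exact gamma1Shape_of_tripod h hc T hi hj hk (by linarith) hp h4.1 h4.2.1 h4.2.2 hE hdeg
  · exact gamma1Shape_of_tripod h hc T.rotate hj hk hi (by simp only [Tripod.rotate]; linarith)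
      hq h4.1 h4.2.1 h4.2.2 hE hdeg
  · exact gamma1Shape_of_tripod h hc T.rotate.rotate hk hi hj
      (by simp only [Tripod.rotate]; linarith) hr h4.1 h4.2.1 h4.2.2 hE hdeg

end MetricGraph

theorem integral_parabola_deriv (d L : ℝ) (x : ℝ) :
    ∫ t in (0 : ℝ)..x, (d / L + L / 2 - 1 * t) = d * x / L + x * (L - x) / 2 := by
  have h : ∀ t ∈ uIcc 0 x, HasDerivAt (fun t => d / L * t + L / 2 * t - t ^ 2 / 2)
      (d / L + L / 2 - 1 * t) t := by
    intro t _
    refine HasDerivAt.congr_deriv ((((hasDerivAt_id t).const_mul (d / L)).add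
      ((hasDerivAt_id t).const_mul (L / 2))).sub ((hasDerivAt_pow 2 t).div_const 2)) ?_
    simp
  rw [intervalIntegral.integral_eq_sub_of_hasDerivAt h
    (by apply Continuous.intervalIntegrable; fun_prop)]
  ring

theorem integral_parabola (α d L : ℝ) (hL : L ≠ 0) :
    ∫ t in (0 : ℝ)..L, (α + d * t / L + t * (L - t) / 2) = α * L + d * L / 2 + L ^ 3 / 12 := by
  have h : ∀ t ∈ uIcc 0 L, HasDerivAt
      (fun t => α * t + d / L * (t ^ 2 / 2) + L / 2 * (t ^ 2 / 2) - t ^ 3 / 6)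
      (α + d * t / L + t * (L - t) / 2) t := by
    intro t _
    refine HasDerivAt.congr_deriv (((((hasDerivAt_id t).const_mul α).add
      (((hasDerivAt_pow 2 t).div_const 2).const_mul (d / L))).add
      (((hasDerivAt_pow 2 t).div_const 2).const_mul (L / 2))).sub
      ((hasDerivAt_pow 3 t).div_const 6)) ?_
    simp; ring
  rw [intervalIntegral.integral_eq_sub_of_hasDerivAt h
    (by apply Continuous.intervalIntegrable; fun_prop)]
  field_simp
  ring

namespace MetricGraph

/-- The function with prescribed vertex values and second derivative `-1` on the edges. -/
noncomputable def parabolaFun (G : MetricGraph) (U : Fin G.N → ℝ) : H1Fun G where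
  toFun i j t := U i + (U j - U i) * t / G.len i j + t * (G.len i j - t) / 2
  deriv i j t := (U j - U i) / G.len i j + G.len i j / 2 - 1 * t
  symm i j h x := by
    have := (G.len_pos i j h).ne'
    rw [G.len_symm j i]
    field_simp
    ring
  vertexCont i j k _ _ := by simp
  deriv_integrable i j _ := by apply Continuous.integrableOn_Icc; fun_prop
  deriv_sq_integrable i j _ := by apply Continuous.integrableOn_Icc; fun_prop
  ftc i j h x hx := by
    rw [integral_parabola_deriv]
    simp
    ring

theorem energyJ_parabolaFun (G : MetricGraph) (U : Fin G.N → ℝ) :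
    energyJ G (parabolaFun G U) = ∑ e ∈ G.edges, G.edgeEnergy U e := by
  rw [← sum_edges, energyJ]
  refine Finset.sum_congr rfl fun i _ => Finset.sum_congr rfl fun j _ => ?_
  split_ifs with h
  · have hL := (G.len_pos i j h.2).ne'
    simp only [parabolaFun, edgeEnergy_mk]
    rw [integral_slope, integral_parabola _ _ _ hL, segEnergy]
    field_simp
    ring
  · rfl

theorem zeroOn_parabolaFun {G : MetricGraph} {U : Fin G.N → ℝ} {V : Set (Fin G.N)}
    (hU : ∀ i ∈ V, U i = 0) : (parabolaFun G U).ZeroOn V := by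
  intro i hi j _
  simp [parabolaFun, hU i hi]

end MetricGraph

/-- The star with center `3` and arms of lengths `a`, `b`, `c`. -/
def starGraph (a b c : ℝ) (ha : 0 < a) (hb : 0 < b) (hc : 0 < c) : MetricGraph where
  N := 4
  edge i j := (i = 3 ∧ j ≠ 3) ∨ (i ≠ 3 ∧ j = 3)
  edge_symm i j h := by tauto
  edge_irrefl i h := by tauto
  len i j := ![a, b, c, 0] i + ![a, b, c, 0] j
  len_symm i j := add_comm _ _
  len_pos i j h := by
    fin_cases i <;> fin_cases j <;> simp_all

section Star

variable {a b c : ℝ} {ha : 0 < a} {hb : 0 < b} {hc : 0 < c}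

theorem starGraph_connected : (starGraph a b c ha hb hc).Connected := by
  refine ⟨by simp [starGraph], fun i j => ?_⟩
  have h3 : ∀ i : Fin 4, Relation.ReflTransGen (starGraph a b c ha hb hc).edge i (3 : Fin 4) ∧
      Relation.ReflTransGen (starGraph a b c ha hb hc).edge (3 : Fin 4) i := by
    intro i
    by_cases h : i = 3
    · subst h; exact ⟨.refl, .refl⟩
    · exact ⟨.single (Or.inr ⟨h, rfl⟩), .single (Or.inl ⟨rfl, h⟩)⟩
  exact (h3 i).1.trans (h3 j).2

theorem sum_starEdges (F : Fin 4 → Fin 4 → ℝ)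
    {dec : ∀ i j : Fin 4, Decidable (i < j ∧ ((i = 3 ∧ j ≠ 3) ∨ (i ≠ 3 ∧ j = 3)))} :
    ∑ i : Fin 4, ∑ j : Fin 4,
      (if i < j ∧ ((i = 3 ∧ j ≠ 3) ∨ (i ≠ 3 ∧ j = 3)) then F i j else 0) =
        F 0 3 + F 1 3 + F 2 3 := by
  simp [Fin.sum_univ_four]

theorem starGraph_totalLength : (starGraph a b c ha hb hc).totalLength = a + b + c := by
  refine (sum_starEdges fun i j => ![a, b, c, 0] i + ![a, b, c, 0] j).trans ?_
  simp

theorem starGraph_sum_edgeEnergy (h : ℝ) :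
    ∑ e ∈ (starGraph a b c ha hb hc).edges,
      (starGraph a b c ha hb hc).edgeEnergy (![0, 0, 0, h] : Fin 4 → ℝ) e =
        segEnergy h 0 a + segEnergy h 0 b + segEnergy h 0 c := by
  rw [← MetricGraph.sum_edges]
  refine (sum_starEdges fun i j => segEnergy ((![0, 0, 0, h] : Fin 4 → ℝ) i)
    ((![0, 0, 0, h] : Fin 4 → ℝ) j) (![a, b, c, 0] i + ![a, b, c, 0] j)).trans ?_
  simp [segEnergy_comm 0 h]

theorem dirEnergy_starGraph_le {F : ℝ} (hF : ∀ U : Fin 4 → ℝ,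
      (∀ i ∈ ({0, 1, 2} : Set (Fin 4)), U i = 0) →
      F ≤ ∑ e ∈ (starGraph a b c ha hb hc).edges, (starGraph a b c ha hb hc).edgeEnergy U e) :
    dirEnergy (starGraph a b c ha hb hc) ({0, 1, 2} : Set (Fin 4)) ≤ -starF a b c := by
  have e := starGraph_sum_edgeEnergy (ha := ha) (hb := hb) (hc := hc)
    ((a + b + c) / (2 * (1 / a + 1 / b + 1 / c)))
  rw [segEnergy_star_eq ha hb hc] at e
  refine (MetricGraph.dirEnergy_le hF (MetricGraph.zeroOn_parabolaFun ?_)).trans_eq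
    ((MetricGraph.energyJ_parabolaFun _ _).trans e)
  rintro i (rfl | rfl | rfl) <;> rfl

end Star

theorem eVariationOn_Icc_of_dist_eq {E : Type*} [PseudoMetricSpace E] {f : ℝ → E}
    (hf : ∀ s t, dist (f s) (f t) = |s - t|) {s t : ℝ} (hst : s ≤ t) :
    eVariationOn f (Icc s t) = ENNReal.ofReal (t - s) := by
  have he : ∀ u v, edist (f u) (f v) = edist u v := fun u v => by
    rw [edist_dist, edist_dist, hf, Real.dist_eq]
  have : eVariationOn f (Icc s t) = eVariationOn id (Icc s t) := by
    simp only [eVariationOn, he, id]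
  rw [this]
  apply le_antisymm
  · simp
  · refine le_trans (le_of_eq ?_)
      (eVariationOn.edist_le id (right_mem_Icc.2 hst) (left_mem_Icc.2 hst))
    rw [edist_dist, Real.dist_eq, id, id, abs_of_nonneg (sub_nonneg.2 hst)]

/-- The immersion of a metric graph by straight segments. -/
noncomputable def lineImmersion {d : ℕ} (G : MetricGraph)
    (P : Fin G.N → EuclideanSpace ℝ (Fin d))
    (hP : ∀ i j, G.edge i j → dist (P i) (P j) = G.len i j) : Immersion G d :=
  have key : ∀ i j, G.edge i j → ∀ s t : ℝ,
      dist (AffineMap.lineMap (P i) (P j) (s / G.len i j))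
        (AffineMap.lineMap (P i) (P j) (t / G.len i j)) = |s - t| := by
    intro i j h s t
    have hL := G.len_pos i j h
    rw [dist_lineMap_lineMap, hP i j h, Real.dist_eq, ← sub_div, abs_div, abs_of_pos hL]
    field_simp
  { toFun := fun i j t => AffineMap.lineMap (P i) (P j) (t / G.len i j)
    vpos := P
    start := fun i j _ => by simp
    symm := fun i j h t => by
      have hL := G.len_pos i j h
      rw [G.len_symm j i, sub_div, div_self hL.ne', AffineMap.lineMap_apply_one_sub]
    arclen := fun i j h s t _ hst _ => eVariationOn_Icc_of_dist_eq (key i j h) hst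
    inj := fun i j h s _ t _ hst => by
      have := key i j h s t
      rw [dist_eq_zero.2 hst] at this
      exact sub_eq_zero.1 (abs_eq_zero.1 this.symm) }

theorem lineMap_pt (a b a' b' t : ℝ) :
    AffineMap.lineMap (pt a b) (pt a' b') t = pt (a + t * (a' - a)) (b + t * (b' - b)) := by
  ext i
  fin_cases i <;> simp [pt, AffineMap.lineMap_apply] <;> ring

theorem pt_inj {a b a' b' : ℝ} : pt a b = pt a' b' ↔ a = a' ∧ b = b' := by
  simp [pt]

/-- The horizontal coordinates of the vertices of `Γ₁`. -/
noncomputable def gammaX (y : ℝ) : Fin 4 → ℝ := ![-√3 / 3, √3 / 6, √3 / 6, √3 / 6 - y]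

/-- The vertical coordinates of the vertices of `Γ₁`. -/
noncomputable def gammaY : Fin 4 → ℝ := ![0, -(1 / 2), 1 / 2, 0]

namespace Gamma1Param

variable {l x y : ℝ}

theorem x_pos (h : Gamma1Param l x y) : 0 < x := by linarith [h.half_le]

theorem long_pos (h : Gamma1Param l x y) : 0 < √3 / 2 - y := by
  have h3 : (√3) ^ 2 = 3 := Real.sq_sqrt (by norm_num)
  have := Real.sqrt_nonneg 3
  nlinarith [h.sq_eq, h.three_sq_le, h.y_nonneg]

/-- The metric tree `Γ₁`. -/
noncomputable def graph (h : Gamma1Param l x y) : MetricGraph :=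
  starGraph (√3 / 2 - y) x x h.long_pos h.x_pos h.x_pos

theorem dist_eq_len (h : Gamma1Param l x y) (i j : Fin h.graph.N) (hij : h.graph.edge i j) :
    dist (pt (gammaX y i) (gammaY i)) (pt (gammaX y j) (gammaY j)) = h.graph.len i j := by
  have e1 : dist (pt (-√3 / 3) 0) (pt (√3 / 6 - y) 0) = √3 / 2 - y := by
    rw [dist_pt_pt, ← Real.sqrt_sq h.long_pos.le]; congr 1; ring
  have e2 : dist (pt (√3 / 6) (-(1 / 2))) (pt (√3 / 6 - y) 0) = x := by
    rw [dist_pt_pt, ← Real.sqrt_sq h.x_pos.le, h.sq_eq]; congr 1; ring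
  have e3 : dist (pt (√3 / 6) (1 / 2)) (pt (√3 / 6 - y) 0) = x := by
    rw [dist_pt_pt, ← Real.sqrt_sq h.x_pos.le, h.sq_eq]; congr 1; ring
  change Fin 4 at i j
  have h3 : ∀ k : Fin 4, k ≠ 3 → dist (pt (gammaX y k) (gammaY k))
      (pt (gammaX y 3) (gammaY 3)) = ![√3 / 2 - y, x, x, 0] k + ![√3 / 2 - y, x, x, 0] 3 := by
    intro k hk
    fin_cases k
    · simpa [gammaX, gammaY] using e1
    · simpa [gammaX, gammaY] using e2
    · simpa [gammaX, gammaY] using e3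
    · exact absurd rfl hk
  rcases hij with ⟨rfl, hj⟩ | ⟨hi, rfl⟩
  · rw [dist_comm]
    exact (h3 j hj).trans (add_comm _ _)
  · exact h3 i hi

/-- The embedding of `Γ₁` in the plane. -/
noncomputable def immersion (h : Gamma1Param l x y) : Immersion h.graph 2 :=
  lineImmersion h.graph (fun i => pt (gammaX y i) (gammaY i)) h.dist_eq_len

theorem vpos_image (h : Gamma1Param l x y) :
    h.immersion.vpos '' ({0, 1, 2} : Set (Fin 4)) = trianglePts := by
  change (fun i : Fin 4 => pt (gammaX y i) (gammaY i)) '' ({0, 1, 2} : Set (Fin 4)) = _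
  simp [Set.image_insert_eq, trianglePts, gammaX, gammaY]

theorem immersion_eq_lineMap (h : Gamma1Param l x y) (i j : Fin 4) (hij : h.graph.edge i j) :
    ∃ k : Fin 4, k ≠ 3 ∧ (i = 3 ∧ j = k ∨ i = k ∧ j = 3) ∧ ∀ t : ℝ, ∃ s : ℝ,
      (0 ≤ t → t ≤ h.graph.len i j → 0 ≤ s ∧ s ≤ 1) ∧ (0 < t → t < h.graph.len i j → 0 < s) ∧
      h.immersion.toFun i j t = pt (gammaX y 3 + s * (gammaX y k - gammaX y 3))
        (gammaY 3 + s * (gammaY k - gammaY 3)) := by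
  have hL := h.graph.len_pos i j hij
  rcases hij with ⟨rfl, hj⟩ | ⟨hi, rfl⟩
  · refine ⟨j, hj, .inl ⟨rfl, rfl⟩, fun t => ⟨t / h.graph.len (3 : Fin 4) j, ?_, ?_, lineMap_pt _ _ _ _ _⟩⟩
    · intro h0 h1
      exact ⟨div_nonneg h0 hL.le, (div_le_one hL).2 h1⟩
    · intro h0 _
      exact div_pos h0 hL
  · refine ⟨i, hi, .inr ⟨rfl, rfl⟩, fun t => ⟨1 - t / h.graph.len i (3 : Fin 4), ?_, ?_, ?_⟩⟩
    · intro h0 h1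
      exact ⟨sub_nonneg.2 ((div_le_one hL).2 h1), by linarith [div_nonneg h0 hL.le]⟩
    · intro _ h1
      exact sub_pos.2 ((div_lt_one hL).2 h1)
    · rw [← lineMap_pt, AffineMap.lineMap_apply_one_sub]
      rfl

theorem immersion_isEmbedding (h : Gamma1Param l x y) : h.immersion.IsEmbedding := by
  have ha := h.long_pos
  have h3 : 0 < √3 := by positivity
  refine ⟨fun (i j i' j' : Fin 4) hij hij' hne t ht t' ht' heq => ?_,
    fun (i j : Fin 4) hij => ?_⟩
  · obtain ⟨k, hk, hijk, hs⟩ := h.immersion_eq_lineMap i j hij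
    obtain ⟨k', hk', hijk', hs'⟩ := h.immersion_eq_lineMap i' j' hij'
    have hkk : k ≠ k' := by
      rintro rfl
      rcases hijk with ⟨rfl, rfl⟩ | ⟨rfl, rfl⟩ <;> rcases hijk' with ⟨rfl, rfl⟩ | ⟨rfl, rfl⟩ 
      · exact hne (.inl ⟨rfl, rfl⟩)
      · exact hne (.inr ⟨rfl, rfl⟩)
      · exact hne (.inr ⟨rfl, rfl⟩)
      · exact hne (.inl ⟨rfl, rfl⟩)
    obtain ⟨s, -, hpos, hs⟩ := hs t
    obtain ⟨s', hIcc, -, hs'⟩ := hs' t'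
    have hpos := hpos ht.1 ht.2
    have hIcc := hIcc ht'.1 ht'.2
    rw [hs, hs', pt_inj] at heq
    clear hs hs' hijk hijk' hij hij' ht ht' hne
    obtain ⟨h1, h2⟩ := heq
    have := mul_pos hpos ha
    fin_cases k <;> fin_cases k' <;> simp [gammaX, gammaY] at h1 h2 hk hk' hkk <;>
      first
        | linarith [hIcc.1]
        | (subst h2; linarith)
  · replace hij := pt_inj.1 hij
    change (i : Fin 4) = j
    fin_cases i <;> fin_cases j <;> simp [gammaX, gammaY] at hij ⊢ <;> linarith

end Gamma1Param

theorem mem_Icc_bounds {x : ℝ} (hx : x ∈ Icc (1 / 2 : ℝ) (1 / √3)) :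
    1 / 2 ≤ x ∧ 3 * x ^ 2 ≤ 1 ∧ √(x ^ 2 - 1 / 4) ^ 2 = x ^ 2 - 1 / 4 := by
  have h3 : 0 < √3 := by positivity
  have h3' : (√3) ^ 2 = 3 := Real.sq_sqrt (by norm_num)
  have h1 := hx.1
  have h2 := (le_div_iff₀ h3).1 hx.2
  refine ⟨h1, ?_, Real.sq_sqrt (by nlinarith)⟩
  have : (x * √3) ^ 2 ≤ 1 := pow_le_one₀ (by positivity) h2
  nlinarith

theorem Gamma1Param.of_mem_Icc {l x : ℝ} (hl : l ≤ 1 + √3 / 2)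
    (hx : x ∈ Icc (1 / 2 : ℝ) (1 / √3)) (h : 2 * x + √3 / 2 - √(x ^ 2 - 1 / 4) = l) :
    Gamma1Param l x (√(x ^ 2 - 1 / 4)) := by
  obtain ⟨h1, h2, h3⟩ := mem_Icc_bounds hx
  exact ⟨Real.sqrt_nonneg _, by linarith, h1, h2, h, hl⟩

theorem exists_gamma1_length_eq {l : ℝ} (hl₁ : √3 ≤ l) (hl₂ : l ≤ 1 + √3 / 2) :
    ∃ x ∈ Icc (1 / 2 : ℝ) (1 / √3), 2 * x + √3 / 2 - √(x ^ 2 - 1 / 4) = l := by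
  have h3 : 0 < √3 := by positivity
  have h3' : (√3) ^ 2 = 3 := Real.sq_sqrt (by norm_num)
  have hle : (1 / 2 : ℝ) ≤ 1 / √3 := by
    apply one_div_le_one_div_of_le h3
    rw [Real.sqrt_le_left (by norm_num)]; norm_num
  have hcont : ContinuousOn (fun x => 2 * x + √3 / 2 - √(x ^ 2 - 1 / 4))
      (Icc (1 / 2 : ℝ) (1 / √3)) := by fun_prop
  have hx : 1 / √3 = √3 / 3 := by field_simp; exact h3'.symm
  have e1 : √((1 / √3) ^ 2 - 1 / 4) = √3 / 6 := by
    rw [hx, ← Real.sqrt_sq (by positivity : 0 ≤ √3 / 6)]; congr 1; nlinarith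
  have e2 : √((1 / 2 : ℝ) ^ 2 - 1 / 4) = 0 := by norm_num
  obtain ⟨x, hx', h⟩ := intermediate_value_Icc' hle hcont
    (show l ∈ Icc _ _ from ⟨by simp only [e1]; rw [hx]; linarith, by simp only [e2]; linarith⟩)
  exact ⟨x, hx', h⟩

theorem gamma1_length_injOn :
    InjOn (fun x => 2 * x + √3 / 2 - √(x ^ 2 - 1 / 4)) (Icc (1 / 2 : ℝ) (1 / √3)) := by
  have key : ∀ x ∈ Icc (1 / 2 : ℝ) (1 / √3), ∀ y ∈ Icc (1 / 2 : ℝ) (1 / √3), y < x →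
      2 * x + √3 / 2 - √(x ^ 2 - 1 / 4) ≠ 2 * y + √3 / 2 - √(y ^ 2 - 1 / 4) := by
    intro x hx y hy hlt h
    obtain ⟨x1, x2, x3⟩ := mem_Icc_bounds hx
    obtain ⟨y1, y2, y3⟩ := mem_Icc_bounds hy
    set p := √(x ^ 2 - 1 / 4)
    set q := √(y ^ 2 - 1 / 4)
    have hq : 0 ≤ q := Real.sqrt_nonneg _
    have hpq : p - q = 2 * (x - y) := by linarith
    have hsum : 2 * (p + q) = x + y := by
      have : (x - y) * (2 * (p + q) - (x + y)) = 0 := by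
        linear_combination (p + q) * (-hpq) + x3 - y3
      rcases mul_eq_zero.1 this with h | h <;> linarith
    have hp : 2 * p ≤ x := abs_le_of_sq_le_sq' (by nlinarith) (by linarith) |>.2
    have hq : 2 * q ≤ y := abs_le_of_sq_le_sq' (by nlinarith) (by linarith) |>.2
    have hq' : 2 * q = y := by linarith
    nlinarith
  intro x hx y hy h
  rcases lt_trichotomy x y with hlt | rfl | hlt
  · exact absurd h.symm (key y hy x hx hlt)
  · rfl
  · exact absurd h (key x hx y hy hlt)

namespace Gamma1Param

variable {l x y : ℝ}

theorem graph_totalLength (h : Gamma1Param l x y) : h.graph.totalLength = l := by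
  refine starGraph_totalLength.trans ?_
  linarith [h.length]

theorem graph_edge_iff (i j : Fin 4) :
    ((i = 3 ∧ j ≠ 3) ∨ (i ≠ 3 ∧ j = 3)) ↔ (({i, j} : Set (Fin 4)) = {0, 3} ∨
      ({i, j} : Set (Fin 4)) = {1, 3} ∨ ({i, j} : Set (Fin 4)) = {2, 3}) := by
  simp only [Set.pair_eq_pair_iff]
  revert i j
  decide

theorem dirEnergy_graph_le (h : Gamma1Param l x y) :
    dirEnergy h.graph ({0, 1, 2} : Set (Fin 4)) ≤ -starF (√3 / 2 - y) x x :=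
  dirEnergy_starGraph_le fun U hU => MetricGraph.neg_starF_le_sum_edgeEnergy h
    starGraph_connected h.graph_totalLength h.immersion h.vpos_image U hU

end Gamma1Param

/-- Equilateral triangle, moderate length `√3 ≤ l ≤ 1 + √3/2`: there is
a unique `x ∈ [1/2, 1/√3]` with `2x + √3/2 - √(x² - 1/4) = l`; the corresponding tree
`Γ₁` (embedded with `γ(Vᵢ) = Dᵢ`) solves problem (enim), hence also the embedded problem
(enem); and every solution of (enim) all of whose degree-two vertices are Dirichlet
vertices has, up to the rotation by `2π/3` (i.e. up to the labelling of the Dirichlet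
points), the shape of `Γ₁`. -/
theorem equilateral_triangle_moderate_length (l : ℝ)
    (hl₁ : Real.sqrt 3 ≤ l) (hl₂ : l ≤ 1 + Real.sqrt 3 / 2) :
    ∃ x : ℝ,
      (x ∈ Set.Icc (1 / 2 : ℝ) (1 / Real.sqrt 3) ∧
        2 * x + Real.sqrt 3 / 2 - Real.sqrt (x ^ 2 - 1 / 4) = l) ∧
      (∀ y : ℝ, y ∈ Set.Icc (1 / 2 : ℝ) (1 / Real.sqrt 3) →
        2 * y + Real.sqrt 3 / 2 - Real.sqrt (y ^ 2 - 1 / 4) = l → y = x) ∧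
      (∃ (G : MetricGraph) (V : Set (Fin G.N)) (γ : Immersion G 2),
        G.Connected ∧ G.totalLength = l ∧ γ.IsEmbedding ∧
        γ.vpos '' V = ({pt (-(Real.sqrt 3) / 3) 0, pt (Real.sqrt 3 / 6) (-(1 / 2)),
          pt (Real.sqrt 3 / 6) (1 / 2)} : Set (EuclideanSpace ℝ (Fin 2))) ∧
        (∃ v₁ v₂ v₃ v₄ : Fin G.N,
          v₁ ≠ v₂ ∧ v₁ ≠ v₃ ∧ v₁ ≠ v₄ ∧ v₂ ≠ v₃ ∧ v₂ ≠ v₄ ∧ v₃ ≠ v₄ ∧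
          G.N = 4 ∧ V = {v₁, v₂, v₃} ∧
          (∀ i j, G.edge i j ↔ (({i, j} : Set (Fin G.N)) = {v₁, v₄} ∨
            ({i, j} : Set (Fin G.N)) = {v₂, v₄} ∨ ({i, j} : Set (Fin G.N)) = {v₃, v₄})) ∧
          G.len v₁ v₄ = Real.sqrt 3 / 2 - Real.sqrt (x ^ 2 - 1 / 4) ∧
          G.len v₂ v₄ = x ∧ G.len v₃ v₄ = x ∧
          γ.vpos v₁ = pt (-(Real.sqrt 3) / 3) 0 ∧
          γ.vpos v₂ = pt (Real.sqrt 3 / 6) (-(1 / 2)) ∧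
          γ.vpos v₃ = pt (Real.sqrt 3 / 6) (1 / 2)) ∧
        (∀ (G' : MetricGraph) (V' : Set (Fin G'.N)) (γ' : Immersion G' 2),
          G'.Connected → G'.totalLength = l →
          γ'.vpos '' V' = ({pt (-(Real.sqrt 3) / 3) 0, pt (Real.sqrt 3 / 6) (-(1 / 2)),
            pt (Real.sqrt 3 / 6) (1 / 2)} : Set (EuclideanSpace ℝ (Fin 2))) →
          dirEnergy G V ≤ dirEnergy G' V')) ∧
      (∀ (G : MetricGraph) (V : Set (Fin G.N)) (γ : Immersion G 2),
        G.Connected → G.totalLength = l →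
        γ.vpos '' V = ({pt (-(Real.sqrt 3) / 3) 0, pt (Real.sqrt 3 / 6) (-(1 / 2)),
          pt (Real.sqrt 3 / 6) (1 / 2)} : Set (EuclideanSpace ℝ (Fin 2))) →
        (∀ (G' : MetricGraph) (V' : Set (Fin G'.N)) (γ' : Immersion G' 2),
          G'.Connected → G'.totalLength = l →
          γ'.vpos '' V' = ({pt (-(Real.sqrt 3) / 3) 0, pt (Real.sqrt 3 / 6) (-(1 / 2)),
            pt (Real.sqrt 3 / 6) (1 / 2)} : Set (EuclideanSpace ℝ (Fin 2))) →
          dirEnergy G V ≤ dirEnergy G' V') →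
        (∀ i, G.degree i = 2 → i ∈ V) →
        Gamma1Shape x G V) := by
  obtain ⟨x, hx, hlen⟩ := exists_gamma1_length_eq hl₁ hl₂
  have h := Gamma1Param.of_mem_Icc hl₂ hx hlen
  refine ⟨x, ⟨hx, hlen⟩, fun y hy hy' => gamma1_length_injOn hy hx (hy'.trans hlen.symm), ?_, ?_⟩
  · refine ⟨h.graph, ({0, 1, 2} : Set (Fin 4)), h.immersion, starGraph_connected,
      h.graph_totalLength, h.immersion_isEmbedding, h.vpos_image, ?_, ?_⟩
    · have hne : ∀ m n : Fin 4, m.val ≠ n.val → m ≠ n := fun _ _ => Fin.ne_of_val_ne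
      exact ⟨(0 : Fin 4), (1 : Fin 4), (2 : Fin 4), (3 : Fin 4),
        hne 0 1 (by decide), hne 0 2 (by decide), hne 0 3 (by decide), hne 1 2 (by decide),
        hne 1 3 (by decide), hne 2 3 (by decide), rfl, rfl, Gamma1Param.graph_edge_iff,
        add_zero _, add_zero _, add_zero _, rfl, rfl, rfl⟩
    · intro G' V' γ' hc hl hV
      exact h.dirEnergy_graph_le.trans
        (MetricGraph.le_dirEnergy (MetricGraph.neg_starF_le_sum_edgeEnergy h hc hl γ' hV))
  · intro G V γ hc hl hV hmin hdeg
    exact MetricGraph.gamma1Shape_of_dirEnergy_le h hc hl γ hV ((hmin h.graph _ h.immersion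
      starGraph_connected h.graph_totalLength h.vpos_image).trans h.dirEnergy_graph_le) hdeg
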